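/- arXiv:2205.13094 — 3 statements merged into one kernel-verified Lean document; each statement's English description precedes it below -/
import Mathlib

section
/- Let n_min ≥ 1 and n_maj > n_min be integers and τ ∈ [0,1]. The minimax excess risk over the group-covariate shift class P_GS(τ) is lower bounded as: inf over all measurable algorithms A of sup over (P_maj, P_min) ∈ P_GS(τ) of ExcessRisk[A; (P_maj, P_min)] ≥ 1/(200 · (n_min·(2−τ) + n_maj·τ)^{1/3}), and consequently, writing ρ = n_maj/n_min, the minimax excess risk is also at least 1/(200 · n_min^{1/3} · (ρ·τ + 2)^{1/3}). -/
open MeasureTheory Set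
open scoped ENNReal Classical

noncomputable section

/-! ## Basic setup: distributions on `ℝ × Bool`, risk, excess risk.

A labelled example is a pair `(x, y) : ℝ × Bool`, where the label `true` codes `+1`
and `false` codes `-1`; features are supported on `[0,1]`. -/

/-- The risk (probability of misclassification) of a classifier `f : ℝ → Bool`
under a distribution `P` on `ℝ × Bool`. -/
def risk (f : ℝ → Bool) (P : Measure (ℝ × Bool)) : ℝ :=
  (P {p : ℝ × Bool | f p.1 ≠ p.2}).toReal

/-- The Bayes risk of a distribution: the infimum of the risk over all classifiers. -/
def bayesRisk (P : Measure (ℝ × Bool)) : ℝ :=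
  ⨅ f : ℝ → Bool, risk f P

/-- The balanced test distribution `P_test = (1/2) P_maj + (1/2) P_min`. -/
def testMeasure (Pmaj Pmin : Measure (ℝ × Bool)) : Measure (ℝ × Bool) :=
  (2 : ℝ≥0∞)⁻¹ • Pmaj + (2 : ℝ≥0∞)⁻¹ • Pmin

/-- A training sample: `nmaj` labelled points from the majority distribution and
`nmin` labelled points from the minority distribution. -/
abbrev Sample (nmaj nmin : ℕ) : Type :=
  (Fin nmaj → ℝ × Bool) × (Fin nmin → ℝ × Bool)

/-- The law `P_maj^{n_maj} × P_min^{n_min}` of the training sample. -/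
def sampleMeasure (nmaj nmin : ℕ) (Pmaj Pmin : Measure (ℝ × Bool)) :
    Measure (Sample nmaj nmin) :=
  (Measure.pi fun _ : Fin nmaj => Pmaj).prod (Measure.pi fun _ : Fin nmin => Pmin)

/-- An algorithm (a map from samples to classifiers) is measurable if the joint map
`(S, x) ↦ A S x` is measurable. -/
def MeasurableAlg (nmaj nmin : ℕ) (A : Sample nmaj nmin → ℝ → Bool) : Prop :=
  Measurable fun p : Sample nmaj nmin × ℝ => A p.1 p.2

/-- The expected excess risk of the algorithm `A` on the pair `(P_maj, P_min)`:
`E_{S ~ P_maj^{n_maj} × P_min^{n_min}}[R(A^S; P_test)] - R(f^*; P_test)`. -/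
def excessRisk (nmaj nmin : ℕ) (A : Sample nmaj nmin → ℝ → Bool)
    (Pmaj Pmin : Measure (ℝ × Bool)) : ℝ :=
  (∫ S, risk (A S) (testMeasure Pmaj Pmin) ∂sampleMeasure nmaj nmin Pmaj Pmin)
    - bayesRisk (testMeasure Pmaj Pmin)

/-- The distribution on `ℝ × Bool` supported on label `y` whose feature has density `p`
(w.r.t. Lebesgue measure) on `[0,1]`. -/
def labelMeasure (p : ℝ → ℝ) (y : Bool) : Measure (ℝ × Bool) :=
  Measure.map (fun x => (x, y))
    ((volume.restrict (Icc (0:ℝ) 1)).withDensity fun x => ENNReal.ofReal (p x))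

/-- The label-shift class `𝒫_LS`: `P_maj(x,y) = P₁(x)·1{y = 1}`,
`P_min(x,y) = P₋₁(x)·1{y = -1}` with `P₁, P₋₁` 1-Lipschitz densities on `[0,1]`. -/
def memLS (Pmaj Pmin : Measure (ℝ × Bool)) : Prop :=
  ∃ p1 pm1 : ℝ → ℝ,
    (∀ x, 0 ≤ p1 x) ∧ (∀ x, 0 ≤ pm1 x) ∧
    LipschitzOnWith 1 p1 (Icc 0 1) ∧ LipschitzOnWith 1 pm1 (Icc 0 1) ∧
    (∫ x in Icc (0:ℝ) 1, p1 x) = 1 ∧ (∫ x in Icc (0:ℝ) 1, pm1 x) = 1 ∧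
    Pmaj = labelMeasure p1 true ∧ Pmin = labelMeasure pm1 false

/-- Total variation distance between two densities on `[0,1]`:
`TV(p, q) = (1/2)∫₀¹ |p - q|`. -/
def tvDist (p q : ℝ → ℝ) : ℝ :=
  (1/2) * ∫ x in Icc (0:ℝ) 1, |p x - q x|

/-- The distribution on `ℝ × Bool` whose feature has density `p` on `[0,1]` and whose
label is `true` with probability `η x` conditionally on the feature `x`. -/
def covMeasure (p η : ℝ → ℝ) : Measure (ℝ × Bool) :=
  labelMeasure (fun x => p x * η x) true + labelMeasure (fun x => p x * (1 - η x)) false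

/-- The group-covariate shift class `𝒫_GS(τ)`: `P_maj(x,y) = P_a(x)·P(y|x)`,
`P_min(x,y) = P_b(x)·P(y|x)` with group densities `P_a, P_b` on `[0,1]`,
a shared 1-Lipschitz conditional label distribution, and overlap
`1 - TV(P_a, P_b) ≥ τ`. -/
def memGS (τ : ℝ) (Pmaj Pmin : Measure (ℝ × Bool)) : Prop :=
  ∃ pa pb η : ℝ → ℝ,
    (∀ x, 0 ≤ pa x) ∧ (∀ x, 0 ≤ pb x) ∧
    (∫ x in Icc (0:ℝ) 1, pa x) = 1 ∧ (∫ x in Icc (0:ℝ) 1, pb x) = 1 ∧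
    (∀ x, 0 ≤ η x ∧ η x ≤ 1) ∧
    LipschitzOnWith 1 η (Icc 0 1) ∧ LipschitzOnWith 1 (fun x => 1 - η x) (Icc 0 1) ∧
    τ ≤ 1 - tvDist pa pb ∧
    Pmaj = covMeasure pa η ∧ Pmin = covMeasure pb η

/-! ## The hat function -/

/-- The hat function `φ_K`. -/
def hatFun (K : ℕ) (x : ℝ) : ℝ :=
  if x ∈ Icc (-(1/(2*(K:ℝ)))) 0 then |x + 1/(4*(K:ℝ))| - 1/(4*(K:ℝ))
  else if x ∈ Icc (0:ℝ) (1/(2*(K:ℝ))) then 1/(4*(K:ℝ)) - |x - 1/(4*(K:ℝ))|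
  else 0

/-! ## The hard family for the label-shift lower bound.

Bins are 0-indexed: `I_j = [j/K, (j+1)/K)` for `j = 0, …, K-1`, corresponding to the
paper's `I_{j+1} = [((j+1)-1)/K, (j+1)/K]`; the bin center is `(j + 1/2)/K`. -/

/-- The value in `{-1, 0, 1}` coded by an element of `Fin 3`. -/
def trit (i : Fin 3) : ℝ := (i : ℝ) - 1

/-- The perturbed density of the hard label-shift family: on the bin
`I_j = [j/K, (j+1)/K)` it equals `1 + v_j · φ_K(x - (j + 1/2)/K)`. -/
def hardDensityLS (K : ℕ) (v : Fin K → Fin 3) (x : ℝ) : ℝ :=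
  1 + ∑ j : Fin K,
    (if x ∈ Ico ((j:ℝ)/(K:ℝ)) (((j:ℝ)+1)/(K:ℝ))
      then trit (v j) * hatFun K (x - ((j:ℝ) + 1/2)/(K:ℝ)) else 0)

/-- The index set `𝒱 = {-1,0,1}^K × {-1,0,1}^K` of the hard label-shift family. -/
abbrev TritPair (K : ℕ) : Type := (Fin K → Fin 3) × (Fin K → Fin 3)

/-- The law `Q(S | v) = P_{v,maj}^{n_maj} × P_{v,min}^{n_min}` of the sample for the hard
label-shift instance indexed by `v`. -/
def hardLSMeasure (K nmaj nmin : ℕ) (v : TritPair K) : Measure (Sample nmaj nmin) :=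
  sampleMeasure nmaj nmin (labelMeasure (hardDensityLS K v.1) true)
    (labelMeasure (hardDensityLS K v.2) false)

/-- The marginal law `Q_S` of the sample when the index `V` is uniform on `𝒱`. -/
def hardLSMarginal (K nmaj nmin : ℕ) : Measure (Sample nmaj nmin) :=
  ∑ v : TritPair K, (Fintype.card (TritPair K) : ℝ≥0∞)⁻¹ • hardLSMeasure K nmaj nmin v

/-- The posterior weight `Q(v | S)`: the Radon–Nikodym derivative of
`(1/|𝒱|) · Q(S | v)` with respect to `Q_S`, evaluated at `S`. -/
def postLS (K nmaj nmin : ℕ) (v : TritPair K) (S : Sample nmaj nmin) : ℝ :=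
  (((Fintype.card (TritPair K) : ℝ≥0∞)⁻¹ • hardLSMeasure K nmaj nmin v).rnDeriv
      (hardLSMarginal K nmaj nmin) S).toReal

/-- The posterior mixture density `Σ_{v ∈ 𝒱} Q(v | S) · P_{v, ±1}`;
`cls = true` selects the class `+1` densities `P_{v,1}`. -/
def postMixLS (K nmaj nmin : ℕ) (S : Sample nmaj nmin) (cls : Bool) (x : ℝ) : ℝ :=
  ∑ v : TritPair K,
    postLS K nmaj nmin v S * hardDensityLS K (if cls then v.1 else v.2) x

/-! ## The hard family for the group-covariate shift lower bound -/

/-- The sign `+1` / `-1` coded by a Bool. -/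
def sgnB (b : Bool) : ℝ := if b then 1 else -1

/-- `P_v(y = 1 | x)` for the hard group-shift family: on the bin `I_j = [j/K, (j+1)/K)` it
equals `(1/2)(1 + v_j · φ_K(x - (j+1/2)/K))`. -/
def hardEta (K : ℕ) (v : Fin K → Bool) (x : ℝ) : ℝ :=
  (1/2) * (1 + ∑ j : Fin K,
    (if x ∈ Ico ((j:ℝ)/(K:ℝ)) (((j:ℝ)+1)/(K:ℝ))
      then sgnB (v j) * hatFun K (x - ((j:ℝ) + 1/2)/(K:ℝ)) else 0))

/-- The majority-group feature density: `2 - τ` on `[0, 1/2)` and `τ` on `[1/2, 1]`. -/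
def hardPa (τ : ℝ) (x : ℝ) : ℝ := if x < 1/2 then 2 - τ else τ

/-- The minority-group feature density `P_b = 2 - P_a`. -/
def hardPb (τ : ℝ) (x : ℝ) : ℝ := 2 - hardPa τ x

/-- The law `Q(S | v)` of the sample for the hard group-shift instance indexed by `v`. -/
def hardGSMeasure (K nmaj nmin : ℕ) (τ : ℝ) (v : Fin K → Bool) :
    Measure (Sample nmaj nmin) :=
  sampleMeasure nmaj nmin (covMeasure (hardPa τ) (hardEta K v))
    (covMeasure (hardPb τ) (hardEta K v))

/-- The conditional law `Q(S | v_j = b)` of the sample given the `j`-th coordinate of the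
uniformly random index: the uniform mixture over all `v` with `v_j = b`. -/
def condGS (K nmaj nmin : ℕ) (τ : ℝ) (j : Fin K) (b : Bool) :
    Measure (Sample nmaj nmin) :=
  ((Finset.univ.filter fun v : Fin K → Bool => v j = b).card : ℝ≥0∞)⁻¹ •
    ∑ v ∈ Finset.univ.filter (fun v : Fin K → Bool => v j = b),
      hardGSMeasure K nmaj nmin τ v

/-- The Kullback–Leibler divergence `KL(μ ‖ ν) = ∫ log (dμ/dν) dμ`. -/
def klDiv' {α : Type*} [MeasurableSpace α] (μ ν : Measure α) : ℝ :=
  ∫ x, Real.log ((μ.rnDeriv ν x).toReal) ∂μ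

/-! ## The undersampled binning estimator -/

/-- The prediction of the undersampled binning estimator on the bin `I_j = [j/K, (j+1)/K)`
(0-indexed), where `s ⊆ Fin nmaj` is the set of retained majority samples: predict `+1`
iff the samples of the undersampled dataset in the bin with label `+1` strictly
outnumber those with label `-1`. -/
def usbBinPred (nmaj nmin K : ℕ) (s : Finset (Fin nmaj)) (S : Sample nmaj nmin)
    (j : ℕ) : Bool :=
  decide
    ((s.filter fun i => (S.1 i).2 = false ∧
        (S.1 i).1 ∈ Ico ((j:ℝ)/(K:ℝ)) (((j:ℝ)+1)/(K:ℝ))).card +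
      (Finset.univ.filter fun i : Fin nmin => (S.2 i).2 = false ∧
        (S.2 i).1 ∈ Ico ((j:ℝ)/(K:ℝ)) (((j:ℝ)+1)/(K:ℝ))).card
      <
      (s.filter fun i => (S.1 i).2 = true ∧
        (S.1 i).1 ∈ Ico ((j:ℝ)/(K:ℝ)) (((j:ℝ)+1)/(K:ℝ))).card +
      (Finset.univ.filter fun i : Fin nmin => (S.2 i).2 = true ∧
        (S.2 i).1 ∈ Ico ((j:ℝ)/(K:ℝ)) (((j:ℝ)+1)/(K:ℝ))).card)

/-- The undersampled binning classifier `A_USB^{S,K}` with `K` bins, given the retained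
majority samples `s`: on each bin it predicts the majority label among the undersampled
data in that bin. -/
def usbClassifier (nmaj nmin K : ℕ) (s : Finset (Fin nmaj)) (S : Sample nmaj nmin) :
    ℝ → Bool :=
  fun x => usbBinPred nmaj nmin K s S (min ⌊x * (K:ℝ)⌋₊ (K - 1))

/-- The expected excess risk of the undersampled binning estimator with `K` bins, where the
`nmin` retained majority samples are drawn uniformly at random without replacement
(uniformly among all subsets of size `nmin`). -/
def usbExcessRisk (nmaj nmin K : ℕ) (Pmaj Pmin : Measure (ℝ × Bool)) : ℝ :=
  (∑ s ∈ Finset.powersetCard nmin (Finset.univ : Finset (Fin nmaj)),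
      ∫ S, risk (usbClassifier nmaj nmin K s S) (testMeasure Pmaj Pmin)
        ∂sampleMeasure nmaj nmin Pmaj Pmin)
    / ((Finset.powersetCard nmin (Finset.univ : Finset (Fin nmaj))).card : ℝ)
  - bayesRisk (testMeasure Pmaj Pmin)

/-- `q_{j,y} = P(y | x ∈ I_j)` for the 0-indexed bin `I_j = [j/K, (j+1)/K)`. -/
def qBin (P : Measure (ℝ × Bool)) (K j : ℕ) (y : Bool) : ℝ :=
  (P ((Ico ((j:ℝ)/(K:ℝ)) (((j:ℝ)+1)/(K:ℝ))) ×ˢ ({y} : Set Bool))).toReal /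
    (P ((Ico ((j:ℝ)/(K:ℝ)) (((j:ℝ)+1)/(K:ℝ))) ×ˢ (univ : Set Bool))).toReal

/-- The excess risk of the binning estimator in the bin `I_j`:
`R_j(A_USB^S) = q_{j, -A_j^S} - min{q_{j,1}, q_{j,-1}}`. -/
def binExcess (nmaj nmin K : ℕ) (s : Finset (Fin nmaj)) (S : Sample nmaj nmin)
    (P : Measure (ℝ × Bool)) (j : ℕ) : ℝ :=
  qBin P K j (!(usbBinPred nmaj nmin K s S j)) - min (qBin P K j true) (qBin P K j false)

/-- The binomial probability mass function `P[Bin(m, p) = k]`. -/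
def binomPMF (m : ℕ) (p : ℝ) (k : ℕ) : ℝ :=
  (m.choose k : ℝ) * p ^ k * (1 - p) ^ (m - k)

/-! ## Product measures with densities and the two-point inequality -/

open ProbabilityTheory in
lemma pi_withDensity_const {ι X : Type*} [Fintype ι] [MeasurableSpace X] (μ : Measure X)
    [IsProbabilityMeasure μ] {f : X → ℝ≥0∞} (hf : Measurable f) [SigmaFinite (μ.withDensity f)] :
    Measure.pi (fun _ : ι => μ.withDensity f) =
      (Measure.pi fun _ : ι => μ).withDensity fun x => ∏ i, f (x i) := by
  refine Measure.pi_eq fun s hs => ?_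
  rw [withDensity_apply _ (MeasurableSet.univ_pi hs),
    ← lintegral_indicator (MeasurableSet.univ_pi hs)]
  have hmeas (i : ι) : Measurable ((s i).indicator f) := hf.indicator (hs i)
  have hprod (x : ι → X) : (univ.pi s).indicator (fun x => ∏ i, f (x i)) x =
      ∏ i, (s i).indicator f (x i) := by
    by_cases hx : x ∈ univ.pi s
    · rw [indicator_of_mem hx]
      exact Finset.prod_congr rfl fun i _ => (indicator_of_mem (hx i (mem_univ i)) f).symm
    · rw [indicator_of_notMem hx]
      obtain ⟨i, hi⟩ : ∃ i, x i ∉ s i := by simpa [Set.mem_pi] using hx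
      exact (Finset.prod_eq_zero (Finset.mem_univ i) (indicator_of_notMem hi f)).symm
  simp_rw [hprod]
  have hind : iIndepFun (fun (i : ι) (x : ι → X) => (s i).indicator f (x i))
      (Measure.pi fun _ : ι => μ) :=
    iIndepFun_pi fun i => (hmeas i).aemeasurable
  rw [lintegral_prod_eq_prod_lintegral_of_indepFun Finset.univ _ hind
    fun i => (hmeas i).comp (measurable_pi_apply i)]
  refine Finset.prod_congr rfl fun i _ => ?_
  have := (measurePreserving_eval (fun _ : ι => μ) i).lintegral_comp (hmeas i)
  simp only [Function.eval] at this
  rw [this, lintegral_indicator (hs i), withDensity_apply _ (hs i)]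

/-- Le Cam's two-point inequality for two measures given by densities `L₁, L₂` whose product is
close to `1`. -/
lemma two_point_withDensity {Ω : Type*} [MeasurableSpace Ω] (Q : Measure Ω)
    [IsProbabilityMeasure Q] {L₁ L₂ D g : Ω → ℝ} (hL₁ : Measurable L₁) (hL₂ : Measurable L₂)
    (h₁ : ∀ x, 0 ≤ L₁ x) (h₂ : ∀ x, 0 ≤ L₂ x)
    (hi₁ : ∫⁻ x, ENNReal.ofReal (L₁ x) ∂Q = 1) (hi₂ : ∫⁻ x, ENNReal.ofReal (L₂ x) ∂Q = 1)
    (hD : Integrable D Q) (hlow : ∀ x, 1 - D x ≤ L₁ x * L₂ x) (hup : ∀ x, L₁ x * L₂ x ≤ 1)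
    (hg : Measurable g) (hg0 : ∀ x, 0 ≤ g x) (hg1 : ∀ x, g x ≤ 1) :
    1 / 2 - ∫ x, D x ∂Q ≤ (∫ x, g x ∂Q.withDensity fun x => ENNReal.ofReal (L₁ x)) +
      ∫ x, (1 - g x) ∂Q.withDensity fun x => ENNReal.ofReal (L₂ x) := by
  have int₁ : Integrable L₁ Q := by
    refine ⟨hL₁.aestronglyMeasurable, ?_⟩
    rw [hasFiniteIntegral_iff_ofReal (ae_of_all _ h₁), hi₁]; simp
  have int₂ : Integrable L₂ Q := by
    refine ⟨hL₂.aestronglyMeasurable, ?_⟩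
    rw [hasFiniteIntegral_iff_ofReal (ae_of_all _ h₂), hi₂]; simp
  have v₁ : ∫ x, L₁ x ∂Q = 1 := by
    rw [integral_eq_lintegral_of_nonneg_ae (ae_of_all _ h₁) hL₁.aestronglyMeasurable, hi₁]; simp
  have v₂ : ∫ x, L₂ x ∂Q = 1 := by
    rw [integral_eq_lintegral_of_nonneg_ae (ae_of_all _ h₂) hL₂.aestronglyMeasurable, hi₂]; simp
  rw [integral_withDensity_eq_integral_toReal_smul hL₁.ennreal_ofReal (by simp),
    integral_withDensity_eq_integral_toReal_smul hL₂.ennreal_ofReal (by simp)]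
  simp only [ENNReal.toReal_ofReal (h₁ _), ENNReal.toReal_ofReal (h₂ _), smul_eq_mul]
  have ig₁ : Integrable (fun x => L₁ x * g x) Q :=
    int₁.mul_bdd (c := 1) hg.aestronglyMeasurable
      (ae_of_all _ fun x => by rw [Real.norm_eq_abs, abs_of_nonneg (hg0 x)]; exact hg1 x)
  have ig₂ : Integrable (fun x => L₂ x * (1 - g x)) Q :=
    int₂.mul_bdd (c := 1) (measurable_const.sub hg).aestronglyMeasurable
      (ae_of_all _ fun x => by
        rw [Real.norm_eq_abs, abs_of_nonneg (by linarith [hg1 x])]; linarith [hg0 x])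
  rw [← integral_add ig₁ ig₂]
  have hlhs : 1 / 2 - ∫ x, D x ∂Q = ∫ x, (1 - D x - 1 / 4 * (L₁ x + L₂ x)) ∂Q := by
    have i₁ : Integrable (fun x => 1 - D x) Q := (integrable_const 1).sub hD
    have i₂ : Integrable (fun x => 1 / 4 * (L₁ x + L₂ x)) Q := (int₁.add int₂).const_mul _
    rw [integral_sub i₁ i₂, integral_sub (integrable_const 1) hD, integral_const_mul,
      integral_add int₁ int₂, v₁, v₂]
    simp; ring
  rw [hlhs]
  refine integral_mono (((integrable_const 1).sub hD).sub ((int₁.add int₂).const_mul _))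
    (ig₁.add ig₂) fun x => ?_
  have key : ∀ a b : ℝ, 0 ≤ a → 0 ≤ b → a * b ≤ 1 → a * b - (a + b) / 4 ≤ a := by
    intro a b ha hb hab
    nlinarith [sq_nonneg (5 * a - b), mul_nonneg ha hb, sq_nonneg (5 * a + b - 4 * (a * b))]
  have k₁ := key _ _ (h₁ x) (h₂ x) (hup x)
  have k₂ := key _ _ (h₂ x) (h₁ x) (by rw [mul_comm]; exact hup x)
  have := hlow x
  simp only
  nlinarith [mul_nonneg (hg0 x) (sub_nonneg.2 k₁),
    mul_nonneg (sub_nonneg.2 (hg1 x)) (sub_nonneg.2 k₂)]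

lemma one_sub_sum_le_prod_one_sub_of_mem_unit {ι : Type*} (s : Finset ι)
    (a : ι → ℝ) (h0 : ∀ i, 0 ≤ a i) (h1 : ∀ i, a i ≤ 1) :
    1 - ∑ i ∈ s, a i ≤ ∏ i ∈ s, (1 - a i) := by
  induction s using Finset.cons_induction with
  | empty => simp
  | cons i s his ih =>
    rw [Finset.sum_cons, Finset.prod_cons]
    have hp : ∏ i ∈ s, (1 - a i) ≤ 1 :=
      Finset.prod_le_one (fun i _ => by linarith [h1 i]) fun i _ => by linarith [h0 i]
    nlinarith [h0 i]

/-- The two-point inequality for samples: if the single-observation laws under the two hypotheses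
have densities `1 + r` and `1 - r`, then no test `g` does well under both hypotheses. -/
lemma two_point_sampleMeasure (nmaj nmin : ℕ) (μ ν : Measure (ℝ × Bool))
    [IsProbabilityMeasure μ] [IsProbabilityMeasure ν] {r : ℝ × Bool → ℝ} (hr : Measurable r)
    (hr1 : ∀ z, |r z| ≤ 1)
    [IsProbabilityMeasure (μ.withDensity fun z => ENNReal.ofReal (1 + r z))]
    [IsProbabilityMeasure (ν.withDensity fun z => ENNReal.ofReal (1 + r z))]
    [IsProbabilityMeasure (μ.withDensity fun z => ENNReal.ofReal (1 - r z))]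
    [IsProbabilityMeasure (ν.withDensity fun z => ENNReal.ofReal (1 - r z))]
    {g : Sample nmaj nmin → ℝ}
    (hg : Measurable g) (hg0 : ∀ S, 0 ≤ g S) (hg1 : ∀ S, g S ≤ 1) :
    1 / 2 - (nmaj * ∫ z, r z ^ 2 ∂μ + nmin * ∫ z, r z ^ 2 ∂ν) ≤
      (∫ S, g S ∂sampleMeasure nmaj nmin (μ.withDensity fun z => ENNReal.ofReal (1 + r z))
        (ν.withDensity fun z => ENNReal.ofReal (1 + r z))) +
      ∫ S, (1 - g S) ∂sampleMeasure nmaj nmin (μ.withDensity fun z => ENNReal.ofReal (1 - r z))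
        (ν.withDensity fun z => ENNReal.ofReal (1 - r z)) := by
  have hb (z : ℝ × Bool) := abs_le.1 (hr1 z)
  have dens {q : ℝ × Bool → ℝ} (hq : Measurable q) (hq0 : ∀ z, 0 ≤ q z)
      (h₁ : IsProbabilityMeasure (μ.withDensity fun z => ENNReal.ofReal (q z)))
      (h₂ : IsProbabilityMeasure (ν.withDensity fun z => ENNReal.ofReal (q z))) :
      sampleMeasure nmaj nmin (μ.withDensity fun z => ENNReal.ofReal (q z))
        (ν.withDensity fun z => ENNReal.ofReal (q z)) =
      (sampleMeasure nmaj nmin μ ν).withDensity fun S =>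
        ENNReal.ofReal ((∏ i, q (S.1 i)) * ∏ i, q (S.2 i)) := by
    unfold sampleMeasure
    rw [pi_withDensity_const μ hq.ennreal_ofReal, pi_withDensity_const ν hq.ennreal_ofReal,
      prod_withDensity (by fun_prop) (by fun_prop)]
    congr 1
    ext S
    rw [ENNReal.ofReal_mul (Finset.prod_nonneg fun i _ => hq0 _),
      ENNReal.ofReal_prod_of_nonneg fun i _ => hq0 _,
      ENNReal.ofReal_prod_of_nonneg fun i _ => hq0 _]
  have dens₁ := dens (q := fun z => 1 + r z) (by fun_prop) (fun z => by linarith [hb z])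
    inferInstance inferInstance
  have dens₂ := dens (q := fun z => 1 - r z) (by fun_prop) (fun z => by linarith [hb z])
    inferInstance inferInstance
  have hQ : IsProbabilityMeasure (sampleMeasure nmaj nmin μ ν) := by
    unfold sampleMeasure; infer_instance
  have mass {q : ℝ × Bool → ℝ}
      (h₁ : IsProbabilityMeasure (μ.withDensity fun z => ENNReal.ofReal (q z)))
      (h₂ : IsProbabilityMeasure (ν.withDensity fun z => ENNReal.ofReal (q z))) :
      sampleMeasure nmaj nmin (μ.withDensity fun z => ENNReal.ofReal (q z))
        (ν.withDensity fun z => ENNReal.ofReal (q z)) univ = 1 := by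
    unfold sampleMeasure; exact measure_univ
  have mass₁ := mass (q := fun z => 1 + r z) inferInstance inferInstance
  have mass₂ := mass (q := fun z => 1 - r z) inferInstance inferInstance
  rw [dens₁, withDensity_apply _ MeasurableSet.univ, Measure.restrict_univ] at mass₁
  rw [dens₂, withDensity_apply _ MeasurableSet.univ, Measure.restrict_univ] at mass₂
  rw [dens₁, dens₂]
  have hr2 (z : ℝ × Bool) : r z ^ 2 ≤ 1 := (sq_le_one_iff_abs_le_one _).2 (hr1 z)
  have ir (P : Measure (ℝ × Bool)) [IsProbabilityMeasure P] : Integrable (fun z => r z ^ 2) P :=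
    Integrable.of_bound (hr.pow_const 2).aestronglyMeasurable 1
      (ae_of_all _ fun z => by rw [Real.norm_eq_abs, abs_of_nonneg (sq_nonneg _)]; exact hr2 z)
  have i₁ (i : Fin nmaj) : Integrable (fun S : Sample nmaj nmin => r (S.1 i) ^ 2)
      (sampleMeasure nmaj nmin μ ν) :=
    (integrable_comp_eval (μ := fun _ => μ) (f := fun z => r z ^ 2) (i := i) (ir μ)).comp_fst _
  have i₂ (i : Fin nmin) : Integrable (fun S : Sample nmaj nmin => r (S.2 i) ^ 2)
      (sampleMeasure nmaj nmin μ ν) :=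
    (integrable_comp_eval (μ := fun _ => ν) (f := fun z => r z ^ 2) (i := i) (ir ν)).comp_snd _
  have e₁ (i : Fin nmaj) : ∫ S, r (S.1 i) ^ 2 ∂sampleMeasure nmaj nmin μ ν = ∫ z, r z ^ 2 ∂μ := by
    unfold sampleMeasure
    rw [integral_fun_fst (fun x : Fin nmaj → ℝ × Bool => r (x i) ^ 2),
      integral_comp_eval (μ := fun _ => μ) (i := i) (ir μ).aestronglyMeasurable]
    simp
  have e₂ (i : Fin nmin) : ∫ S, r (S.2 i) ^ 2 ∂sampleMeasure nmaj nmin μ ν = ∫ z, r z ^ 2 ∂ν := by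
    unfold sampleMeasure
    rw [integral_fun_snd (fun x : Fin nmin → ℝ × Bool => r (x i) ^ 2),
      integral_comp_eval (μ := fun _ => ν) (i := i) (ir ν).aestronglyMeasurable]
    simp
  have hD : ∫ S, ((∑ i, r (S.1 i) ^ 2) + ∑ i, r (S.2 i) ^ 2) ∂sampleMeasure nmaj nmin μ ν =
      nmaj * ∫ z, r z ^ 2 ∂μ + nmin * ∫ z, r z ^ 2 ∂ν := by
    rw [integral_add (integrable_finsetSum _ fun i _ => i₁ i)
      (integrable_finsetSum _ fun i _ => i₂ i), integral_finsetSum _ fun i _ => i₁ i,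
      integral_finsetSum _ fun i _ => i₂ i]
    simp [e₁, e₂]
  rw [← hD]
  have hprod (S : Sample nmaj nmin) :
      ((∏ i, (1 + r (S.1 i))) * ∏ i, (1 + r (S.2 i))) *
        ((∏ i, (1 - r (S.1 i))) * ∏ i, (1 - r (S.2 i))) =
      (∏ i, (1 - r (S.1 i) ^ 2)) * ∏ i, (1 - r (S.2 i) ^ 2) := by
    rw [mul_mul_mul_comm, ← Finset.prod_mul_distrib, ← Finset.prod_mul_distrib]
    congr 1 <;> exact Finset.prod_congr rfl fun i _ => by ring
  have p0 {n : ℕ} (x : Fin n → ℝ × Bool) : 0 ≤ ∏ i, (1 - r (x i) ^ 2) :=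
    Finset.prod_nonneg fun i _ => by linarith [hr2 (x i)]
  have p1 {n : ℕ} (x : Fin n → ℝ × Bool) : ∏ i, (1 - r (x i) ^ 2) ≤ 1 :=
    Finset.prod_le_one (fun i _ => by linarith [hr2 (x i)]) fun i _ => by
      linarith [sq_nonneg (r (x i))]
  have pb {n : ℕ} (x : Fin n → ℝ × Bool) : 1 - ∑ i, r (x i) ^ 2 ≤ ∏ i, (1 - r (x i) ^ 2) :=
    one_sub_sum_le_prod_one_sub_of_mem_unit _ _ (fun i => sq_nonneg _) fun i => hr2 _
  refine two_point_withDensity _ (by fun_prop) (by fun_prop)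
    (fun S => mul_nonneg (Finset.prod_nonneg fun i _ => by linarith [hb (S.1 i)])
      (Finset.prod_nonneg fun i _ => by linarith [hb (S.2 i)]))
    (fun S => mul_nonneg (Finset.prod_nonneg fun i _ => by linarith [hb (S.1 i)])
      (Finset.prod_nonneg fun i _ => by linarith [hb (S.2 i)])) mass₁ mass₂
    ((integrable_finsetSum _ fun i _ => i₁ i).add (integrable_finsetSum _ fun i _ => i₂ i))
    (fun S => ?_) (fun S => ?_) hg hg0 hg1
  · rw [hprod]
    nlinarith [p0 S.1, p0 S.2, p1 S.1, p1 S.2, pb S.1, pb S.2,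
      mul_nonneg (sub_nonneg.2 (p1 S.1)) (sub_nonneg.2 (p1 S.2))]
  · rw [hprod]
    exact mul_le_one₀ (p1 _) (p0 _) (p1 _)

/-! ## Integration and densities for `covMeasure` -/

lemma isProbabilityMeasure_covMeasure {p η : ℝ → ℝ} (hp : ∀ x, 0 ≤ p x)
    (hp1 : ∫ x in Icc (0:ℝ) 1, p x = 1) (hη : ∀ x, 0 ≤ η x ∧ η x ≤ 1)
    (hηm : AEMeasurable η (volume.restrict (Icc (0:ℝ) 1))) :
    IsProbabilityMeasure (covMeasure p η) := by
  have hpi : Integrable p (volume.restrict (Icc (0:ℝ) 1)) := by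
    by_contra h
    rw [integral_undef h] at hp1
    exact zero_ne_one hp1
  refine ⟨?_⟩
  have hlab (q : ℝ → ℝ) (y : Bool) :
      labelMeasure q y univ = ∫⁻ x in Icc (0:ℝ) 1, ENNReal.ofReal (q x) := by
    rw [labelMeasure, Measure.map_apply (by fun_prop) MeasurableSet.univ, preimage_univ,
      withDensity_apply _ MeasurableSet.univ, Measure.restrict_univ]
  rw [covMeasure, Measure.add_apply, hlab, hlab,
    ← lintegral_add_left' (by exact (hpi.aemeasurable.mul hηm).ennreal_ofReal)]
  have (x : ℝ) : ENNReal.ofReal (p x * η x) + ENNReal.ofReal (p x * (1 - η x)) =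
      ENNReal.ofReal (p x) := by
    rw [← ENNReal.ofReal_add (mul_nonneg (hp x) (hη x).1)
      (mul_nonneg (hp x) (by linarith [(hη x).2]))]
    congr 1; ring
  simp_rw [this]
  rw [← ofReal_integral_eq_lintegral_ofReal hpi (ae_of_all _ hp), hp1, ENNReal.ofReal_one]

lemma integral_labelMeasure {q : ℝ → ℝ} (hq : Measurable q) (hq0 : ∀ x, 0 ≤ q x) (y : Bool)
    {F : ℝ × Bool → ℝ} (hF : Measurable F) :
    ∫ z, F z ∂labelMeasure q y = ∫ x in Icc (0:ℝ) 1, q x * F (x, y) := by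
  rw [labelMeasure, integral_map (by fun_prop) hF.aestronglyMeasurable,
    integral_withDensity_eq_integral_toReal_smul hq.ennreal_ofReal (by simp)]
  simp only [ENNReal.toReal_ofReal (hq0 _), smul_eq_mul]

lemma integral_covMeasure {p η : ℝ → ℝ} (hpm : Measurable p) (hp : ∀ x, 0 ≤ p x)
    (hp1 : ∫ x in Icc (0:ℝ) 1, p x = 1) (hη : ∀ x, 0 ≤ η x ∧ η x ≤ 1) (hηm : Measurable η)
    {F : ℝ × Bool → ℝ} (hF : Measurable F) {C : ℝ} (hC : ∀ z, |F z| ≤ C) :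
    ∫ z, F z ∂covMeasure p η =
      ∫ x in Icc (0:ℝ) 1, p x * (η x * F (x, true) + (1 - η x) * F (x, false)) := by
  have hprob := isProbabilityMeasure_covMeasure hp hp1 hη hηm.aemeasurable
  have hint : Integrable F (covMeasure p η) :=
    Integrable.of_bound hF.aestronglyMeasurable C (ae_of_all _ hC)
  have hpi : Integrable p (volume.restrict (Icc (0:ℝ) 1)) := by
    by_contra h
    rw [integral_undef h] at hp1
    exact zero_ne_one hp1
  have hbd {e : ℝ → ℝ} (he : Measurable e) (h01 : ∀ x, 0 ≤ e x ∧ e x ≤ 1) (y : Bool) :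
      Integrable (fun x => p x * e x * F (x, y)) (volume.restrict (Icc (0:ℝ) 1)) := by
    refine (hpi.mul_bdd (c := 1) he.aestronglyMeasurable (ae_of_all _ fun x => ?_)).mul_bdd (c := C)
      (hF.comp (by fun_prop : Measurable fun x : ℝ => (x, y))).aestronglyMeasurable
      (ae_of_all _ fun x => hC _)
    rw [Real.norm_eq_abs, abs_of_nonneg (h01 x).1]; exact (h01 x).2
  unfold covMeasure at hint ⊢
  rw [integral_add_measure hint.left_of_add_measure hint.right_of_add_measure,
    integral_labelMeasure (q := fun x => p x * η x) (hpm.mul hηm)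
      (fun x => mul_nonneg (hp x) (hη x).1) _ hF,
    integral_labelMeasure (q := fun x => p x * (1 - η x)) (hpm.mul (measurable_const.sub hηm))
      (fun x => mul_nonneg (hp x) (by linarith [(hη x).2])) _ hF,
    ← integral_add (hbd hηm hη true) (hbd (e := fun x => 1 - η x) (measurable_const.sub hηm)
      (fun x => ⟨by linarith [(hη x).2], by linarith [(hη x).1]⟩) false)]
  exact integral_congr_ae (ae_of_all _ fun x => by simp only; ring)

lemma labelMeasure_withDensity {q : ℝ → ℝ} (hq : Measurable q) (hq0 : ∀ x, 0 ≤ q x) (y : Bool)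
    {g : ℝ × Bool → ℝ} (hg : Measurable g) :
    (labelMeasure q y).withDensity (fun z => ENNReal.ofReal (g z)) =
      labelMeasure (fun x => q x * g (x, y)) y := by
  have hy : Measurable fun x : ℝ => (x, y) := by fun_prop
  ext s hs
  rw [withDensity_apply _ hs, labelMeasure, labelMeasure,
    setLIntegral_map hs hg.ennreal_ofReal hy, Measure.map_apply hy hs,
    ← withDensity_apply _ (hy hs),
    ← withDensity_mul _ hq.ennreal_ofReal
      (g := fun x => ENNReal.ofReal (g (x, y))) (hg.ennreal_ofReal.comp hy)]
  congr 2
  ext x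
  simp [ENNReal.ofReal_mul (hq0 x)]

lemma covMeasure_withDensity {p η η' : ℝ → ℝ} (hpm : Measurable p) (hp : ∀ x, 0 ≤ p x)
    (hη : ∀ x, 0 ≤ η x ∧ η x ≤ 1) (hηm : Measurable η)
    {g : ℝ × Bool → ℝ} (hg : Measurable g) (ht : ∀ x, η x * g (x, true) = η' x)
    (hf : ∀ x, (1 - η x) * g (x, false) = 1 - η' x) :
    (covMeasure p η).withDensity (fun z => ENNReal.ofReal (g z)) = covMeasure p η' := by
  rw [covMeasure, withDensity_add_measure,
    labelMeasure_withDensity (q := fun x => p x * η x) (hpm.mul hηm)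
      (fun x => mul_nonneg (hp x) (hη x).1) _ hg,
    labelMeasure_withDensity (q := fun x => p x * (1 - η x)) (hpm.mul (measurable_const.sub hηm))
      (fun x => mul_nonneg (hp x) (by linarith [(hη x).2])) _ hg]
  simp_rw [mul_assoc, ht, hf]
  rfl

lemma risk_covMeasure {p η : ℝ → ℝ} (hpm : Measurable p) (hp : ∀ x, 0 ≤ p x)
    (hp1 : ∫ x in Icc (0:ℝ) 1, p x = 1) (hη : ∀ x, 0 ≤ η x ∧ η x ≤ 1) (hηm : Measurable η)
    {f : ℝ → Bool} (hf : Measurable f) :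
    risk f (covMeasure p η) = ∫ x in Icc (0:ℝ) 1, p x * (if f x then 1 - η x else η x) := by
  have hs : MeasurableSet {z : ℝ × Bool | f z.1 ≠ z.2} :=
    (measurableSet_eq_fun (hf.comp measurable_fst) measurable_snd).compl
  have h1 : risk f (covMeasure p η) =
      ∫ z, {z : ℝ × Bool | f z.1 ≠ z.2}.indicator (fun _ => (1:ℝ)) z ∂covMeasure p η := by
    rw [integral_indicator_const _ hs]
    simp [risk, Measure.real]
  rw [h1, integral_covMeasure hpm hp hp1 hη hηm (measurable_const.indicator hs) (C := 1)]
  · refine integral_congr_ae (ae_of_all _ fun x => ?_)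
    cases h : f x <;> simp [indicator, h]
  · intro z
    by_cases h : f z.1 ≠ z.2 <;> simp [indicator, h]

lemma risk_testMeasure (f : ℝ → Bool) (P Q : Measure (ℝ × Bool)) [IsFiniteMeasure P]
    [IsFiniteMeasure Q] :
    risk f (testMeasure P Q) = (risk f P + risk f Q) / 2 := by
  simp only [risk, testMeasure, Measure.add_apply, Measure.smul_apply, smul_eq_mul]
  rw [ENNReal.toReal_add (ENNReal.mul_ne_top (by simp) (measure_ne_top _ _))
    (ENNReal.mul_ne_top (by simp) (measure_ne_top _ _)), ENNReal.toReal_mul, ENNReal.toReal_mul]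
  simp; ring

lemma bayesRisk_le_risk (f : ℝ → Bool) (P : Measure (ℝ × Bool)) : bayesRisk P ≤ risk f P :=
  ciInf_le ⟨0, by rintro _ ⟨g, rfl⟩; exact ENNReal.toReal_nonneg⟩ f

lemma excessRisk_le_one (nmaj nmin : ℕ) (A : Sample nmaj nmin → ℝ → Bool)
    (P Q : Measure (ℝ × Bool)) [IsProbabilityMeasure P] [IsProbabilityMeasure Q] :
    excessRisk nmaj nmin A P Q ≤ 1 := by
  have hb : 0 ≤ bayesRisk (testMeasure P Q) :=
    Real.iInf_nonneg fun f => ENNReal.toReal_nonneg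
  have hprob : IsProbabilityMeasure (sampleMeasure nmaj nmin P Q) := by
    unfold sampleMeasure; infer_instance
  have hrisk (f : ℝ → Bool) (R : Measure (ℝ × Bool)) [IsProbabilityMeasure R] : risk f R ≤ 1 :=
    ENNReal.toReal_le_of_le_ofReal zero_le_one (by simpa using prob_le_one)
  have : ∫ S, risk (A S) (testMeasure P Q) ∂sampleMeasure nmaj nmin P Q ≤ 1 := by
    refine (le_abs_self _).trans ?_
    have := norm_integral_le_of_norm_le_const (μ := sampleMeasure nmaj nmin P Q)
      (f := fun S => risk (A S) (testMeasure P Q)) (C := 1) (ae_of_all _ fun S => ?_)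
    · simpa using this
    · rw [Real.norm_eq_abs, abs_of_nonneg (by exact ENNReal.toReal_nonneg), risk_testMeasure]
      linarith [hrisk (A S) P, hrisk (A S) Q]
  unfold excessRisk
  linarith

lemma memGS.isProbabilityMeasure {τ : ℝ} {P Q : Measure (ℝ × Bool)} (h : memGS τ P Q) :
    IsProbabilityMeasure P ∧ IsProbabilityMeasure Q := by
  obtain ⟨pa, pb, η, ha, hb, ha1, hb1, hη, hL, -, -, rfl, rfl⟩ := h
  have hm := hL.continuousOn.aemeasurable (μ := volume) measurableSet_Icc
  exact ⟨isProbabilityMeasure_covMeasure ha ha1 hη hm, isProbabilityMeasure_covMeasure hb hb1 hη hm⟩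

lemma bddAbove_excessRisk (nmaj nmin : ℕ) (τ : ℝ) (A : Sample nmaj nmin → ℝ → Bool) :
    BddAbove (range fun P : {P : Measure (ℝ × Bool) × Measure (ℝ × Bool) // memGS τ P.1 P.2} =>
      excessRisk nmaj nmin A P.1.1 P.1.2) := by
  refine ⟨1, ?_⟩
  rintro _ ⟨⟨P, hP⟩, rfl⟩
  have := hP.isProbabilityMeasure.1
  have := hP.isProbabilityMeasure.2
  exact excessRisk_le_one nmaj nmin A P.1 P.2

/-! ## The hard instances: tent perturbations on `[1/2, 1]` -/

/-- The centre of the `j`-th of the `K` equal subintervals of `[1/2, 1]`. -/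
def tentCenter (K : ℕ) (j : Fin K) : ℝ := 1 / 2 + ((j : ℝ) + 1 / 2) / (2 * K)

/-- The tent of slope one supported on the `j`-th of the `K` equal subintervals of `[1/2, 1]`. -/
def tent (K : ℕ) (j : Fin K) (x : ℝ) : ℝ := max 0 (1 / (4 * K) - |x - tentCenter K j|)

/-- The regression function `1/2 + ∑ⱼ cⱼ tentⱼ`. -/
def tentEta (K : ℕ) (c : Fin K → ℝ) (x : ℝ) : ℝ := 1 / 2 + ∑ j, c j * tent K j x

/-- The function equal to `a` on `[1/2, ∞)` and to `b` on `(-∞, 1/2)`. -/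
def stepDensity (a b x : ℝ) : ℝ := if 1 / 2 ≤ x then a else b

/-- The middle half of the `j`-th of the `K` equal subintervals of `[1/2, 1]`. -/
def tentCore (K : ℕ) (j : Fin K) : Set ℝ :=
  Icc (tentCenter K j - 1 / (8 * K)) (tentCenter K j + 1 / (8 * K))

/-- The Bayes classifier of the regression function `η`. -/
def plugIn (η : ℝ → ℝ) (x : ℝ) : Bool := decide (1 / 2 ≤ η x)

lemma measurable_plugIn {η : ℝ → ℝ} (hη : Measurable η) : Measurable (plugIn η) :=
  measurable_to_bool (by
    have : plugIn η ⁻¹' {true} = {x | 1 / 2 ≤ η x} := by ext; simp [plugIn]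
    rw [this]
    exact measurableSet_le measurable_const hη)

section Tent

variable {K : ℕ}

lemma tent_nonneg (j : Fin K) (x : ℝ) : 0 ≤ tent K j x := le_max_left _ _

lemma tent_le (j : Fin K) (x : ℝ) : tent K j x ≤ 1 / (4 * K) :=
  max_le (by positivity) (by linarith [abs_nonneg (x - tentCenter K j)])

lemma one_div_four_mul_le (j : Fin K) : 1 / (4 * (K : ℝ)) ≤ 1 / 4 := by
  have : (1 : ℝ) ≤ K := by exact_mod_cast j.pos
  rw [div_le_div_iff₀ (by positivity) (by norm_num)]
  linarith

lemma measurable_tent (j : Fin K) : Measurable (tent K j) := by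
  have : Continuous (tent K j) := by unfold tent; fun_prop
  exact this.measurable

lemma measurable_tentEta (c : Fin K → ℝ) : Measurable (tentEta K c) :=
  measurable_const.add (Finset.measurable_sum _ fun j _ => (measurable_tent j).const_mul _)

lemma abs_tent_sub_tent_le (j : Fin K) (x y : ℝ) : |tent K j x - tent K j y| ≤ |x - y| := by
  have h1 := abs_max_sub_max_le_max 0 (1 / (4 * K) - |x - tentCenter K j|) 0
    (1 / (4 * K) - |y - tentCenter K j|)
  have h2 := abs_abs_sub_abs_le_abs_sub (y - tentCenter K j) (x - tentCenter K j)
  rw [sub_sub_sub_cancel_right] at h2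
  rw [sub_sub_sub_cancel_left, sub_self, abs_zero] at h1
  rw [abs_sub_comm x y]
  exact h1.trans (max_le (abs_nonneg _) h2)

lemma le_abs_tentCenter_sub {i j : Fin K} (h : i ≠ j) :
    1 / (2 * (K : ℝ)) ≤ |tentCenter K i - tentCenter K j| := by
  have hK : (0 : ℝ) < K := by exact_mod_cast i.pos
  have h1 : (1 : ℝ) ≤ |(i : ℝ) - j| := by
    have : (1 : ℤ) ≤ |(i : ℤ) - j| := Int.one_le_abs (by
      rw [sub_ne_zero]; exact_mod_cast Fin.val_ne_of_ne h)
    exact_mod_cast this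
  have : tentCenter K i - tentCenter K j = ((i : ℝ) - j) / (2 * K) := by
    unfold tentCenter; ring
  rw [this, abs_div, abs_of_pos (by positivity : (0 : ℝ) < 2 * K)]
  gcongr

lemma tent_add_tent_le {i j : Fin K} (h : i ≠ j) (x y : ℝ) (hx : 0 < tent K i x)
    (hy : 0 < tent K j y) : tent K i x + tent K j y ≤ |x - y| := by
  have h1 := le_abs_tentCenter_sub h
  have ex : tent K i x = 1 / (4 * K) - |x - tentCenter K i| :=
    max_eq_right ((lt_max_iff.1 hx).resolve_left (lt_irrefl 0)).le
  have ey : tent K j y = 1 / (4 * K) - |y - tentCenter K j| :=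
    max_eq_right ((lt_max_iff.1 hy).resolve_left (lt_irrefl 0)).le
  have h2 : 1 / (2 * (K : ℝ)) = 1 / (4 * K) + 1 / (4 * K) := by field_simp; norm_num
  have h3 : |tentCenter K i - tentCenter K j| ≤
      |x - tentCenter K i| + |x - y| + |y - tentCenter K j| := by
    have := abs_sub_le (tentCenter K i) x (tentCenter K j)
    have := abs_sub_le x y (tentCenter K j)
    rw [abs_sub_comm x (tentCenter K i)]
    linarith
  linarith

lemma exists_tent_eq_zero (hK : 0 < K) (x : ℝ) : ∃ j : Fin K, ∀ i, i ≠ j → tent K i x = 0 := by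
  by_cases h : ∃ j, 0 < tent K j x
  · obtain ⟨j, hj⟩ := h
    refine ⟨j, fun i hi => ?_⟩
    by_contra hne
    have hpos := lt_of_le_of_ne (tent_nonneg i x) (Ne.symm hne)
    have := tent_add_tent_le hi x x hpos hj
    simp at this
    linarith
  · push Not at h
    exact ⟨⟨0, hK⟩, fun i _ => le_antisymm (h i) (tent_nonneg i x)⟩

lemma tentEta_eq {x : ℝ} {j : Fin K} (h : ∀ i, i ≠ j → tent K i x = 0) (c : Fin K → ℝ) :
    tentEta K c x = 1 / 2 + c j * tent K j x := by
  rw [tentEta, Finset.sum_eq_single j (fun i _ hi => by rw [h i hi, mul_zero]) (by simp)]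

lemma tentEta_mem (hK : 0 < K) {c : Fin K → ℝ} (hc : ∀ j, |c j| ≤ 1) (x : ℝ) :
    0 ≤ tentEta K c x ∧ tentEta K c x ≤ 1 := by
  obtain ⟨j, hj⟩ := exists_tent_eq_zero hK x
  rw [tentEta_eq hj]
  have h1 := abs_le.1 (hc j)
  have h2 := (tent_le j x).trans (one_div_four_mul_le j)
  have h3 := tent_nonneg j x
  constructor <;> nlinarith

lemma abs_tentEta_sub_le (hK : 0 < K) {c : Fin K → ℝ} (hc : ∀ j, |c j| ≤ 1) (x y : ℝ) :
    |tentEta K c x - tentEta K c y| ≤ |x - y| := by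
  obtain ⟨i, hi⟩ := exists_tent_eq_zero hK x
  obtain ⟨j, hj⟩ := exists_tent_eq_zero hK y
  have hmul (k : Fin K) : |c k * (tent K k x - tent K k y)| ≤ |x - y| := by
    rw [abs_mul]
    exact (mul_le_of_le_one_left (abs_nonneg _) (hc k)).trans (abs_tent_sub_tent_le k x y)
  rw [tentEta_eq hi, tentEta_eq hj, add_sub_add_left_eq_sub]
  by_cases hij : i = j
  · subst hij
    rw [← mul_sub]
    exact hmul i
  rcases (tent_nonneg i x).eq_or_lt with hx | hx
  · have := hmul j
    rwa [hi j (Ne.symm hij), mul_sub, mul_zero, ← mul_zero (c i), hx] at this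
  rcases (tent_nonneg j y).eq_or_lt with hy | hy
  · have := hmul i
    rwa [hj i hij, mul_sub, mul_zero, ← mul_zero (c j), hy] at this
  · refine (abs_sub _ _).trans (le_trans ?_ (tent_add_tent_le hij x y hx hy))
    rw [abs_mul, abs_mul, abs_of_nonneg (tent_nonneg i x), abs_of_nonneg (tent_nonneg j y)]
    exact add_le_add (mul_le_of_le_one_left (tent_nonneg i x) (hc i))
      (mul_le_of_le_one_left (tent_nonneg j y) (hc j))

lemma tentEta_update (c : Fin K → ℝ) (j : Fin K) (s x : ℝ) :
    tentEta K (Function.update c j s) x =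
      tentEta K (Function.update c j 0) x + s * tent K j x := by
  have h (t : ℝ) : ∑ i, Function.update c j t i * tent K i x =
      t * tent K j x + ∑ i ∈ Finset.univ.erase j, c i * tent K i x := by
    rw [← Finset.add_sum_erase _ _ (Finset.mem_univ j), Function.update_self]
    congr 1
    exact Finset.sum_congr rfl fun i hi => by
      rw [Function.update_of_ne (Finset.ne_of_mem_erase hi)]
  rw [tentEta, tentEta, h s, h 0]
  ring

lemma tentEta_update_zero_mul (c : Fin K → ℝ) (j : Fin K) (x : ℝ) :
    tentEta K (Function.update c j 0) x * (2 * tent K j x) = tent K j x := by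
  rcases (tent_nonneg j x).eq_or_lt with h | h
  · rw [← h]; ring
  · have hz (i : Fin K) (hi : i ≠ j) : tent K i x = 0 := by
      by_contra hne
      have := tent_add_tent_le hi x x (lt_of_le_of_ne (tent_nonneg i x) (Ne.symm hne)) h
      rw [sub_self, abs_zero] at this
      linarith [tent_nonneg i x]
    rw [tentEta_eq hz, Function.update_self]
    ring

lemma tent_pos_mem {j : Fin K} {x : ℝ} (h : 0 < tent K j x) :
    x ∈ Icc (tentCenter K j - 1 / (4 * K)) (tentCenter K j + 1 / (4 * K)) := by
  have h1 : 0 < 1 / (4 * K) - |x - tentCenter K j| :=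
    (lt_max_iff.1 h).resolve_left (lt_irrefl 0)
  have := abs_le.1 (sub_pos.1 h1).le
  constructor <;> linarith

lemma half_le_of_tent_pos {j : Fin K} {x : ℝ} (h : 0 < tent K j x) : 1 / 2 ≤ x := by
  have hx := (tent_pos_mem h).1
  have hK : (0 : ℝ) < K := by exact_mod_cast j.pos
  have : 1 / 2 ≤ tentCenter K j - 1 / (4 * K) := by
    have e : tentCenter K j - 1 / (4 * K) = 1 / 2 + (j : ℝ) / (2 * K) := by
      unfold tentCenter; field_simp; ring
    rw [e]
    have : 0 ≤ (j : ℝ) / (2 * K) := by positivity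
    linarith
  linarith

lemma le_tent_of_mem_tentCore {j : Fin K} {x : ℝ} (hx : x ∈ tentCore K j) :
    1 / (8 * (K : ℝ)) ≤ tent K j x := by
  have h1 : |x - tentCenter K j| ≤ 1 / (8 * K) := abs_le.2 ⟨by linarith [hx.1], by linarith [hx.2]⟩
  have h2 : 1 / (4 * (K : ℝ)) = 1 / (8 * K) + 1 / (8 * K) := by
    have : (0 : ℝ) < K := by exact_mod_cast j.pos
    field_simp; norm_num
  exact le_trans (by linarith) (le_max_right _ _)

lemma tentCore_subset (j : Fin K) : tentCore K j ⊆ Icc (1 / 2) 1 := by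
  have hK : (0 : ℝ) < K := by exact_mod_cast j.pos
  intro x hx
  refine ⟨half_le_of_tent_pos (j := j)
    (lt_of_lt_of_le (by positivity) (le_tent_of_mem_tentCore hx)), hx.2.trans ?_⟩
  have hj : (j : ℝ) + 1 ≤ K := by exact_mod_cast j.isLt
  unfold tentCenter
  have : 1 / 2 + ((j : ℝ) + 1 / 2) / (2 * K) + 1 / (8 * K) =
      1 / 2 + ((j : ℝ) + 3 / 4) / (2 * K) := by
    field_simp; ring
  rw [this]
  have : ((j : ℝ) + 3 / 4) / (2 * K) ≤ 1 / 2 := by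
    rw [div_le_div_iff₀ (by positivity) (by norm_num)]; linarith
  linarith

lemma volume_real_tentCore (j : Fin K) : volume.real (tentCore K j) = 1 / (4 * K) := by
  have hK : (0 : ℝ) < K := by exact_mod_cast j.pos
  have h : 1 / (4 * (K : ℝ)) = 1 / (8 * K) + 1 / (8 * K) := by field_simp; norm_num
  have h' : (0 : ℝ) < 1 / (8 * K) := by positivity
  rw [tentCore, Real.volume_real_Icc_of_le (by linarith)]
  linarith

end Tent

lemma measurable_stepDensity (a b : ℝ) : Measurable (stepDensity a b) :=
  Measurable.ite measurableSet_Ici measurable_const measurable_const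

lemma stepDensity_nonneg {a b : ℝ} (ha : 0 ≤ a) (hb : 0 ≤ b) (x : ℝ) : 0 ≤ stepDensity a b x := by
  unfold stepDensity; split_ifs <;> assumption

lemma integral_stepDensity (a b : ℝ) :
    ∫ x in Icc (0:ℝ) 1, stepDensity a b x = (a + b) / 2 := by
  have h : stepDensity a b =
      fun x => (Ici (1 / 2 : ℝ)).indicator (fun _ => a - b) x + b := by
    ext x
    simp only [stepDensity, indicator, mem_Ici]
    split_ifs <;> ring
  rw [h, integral_add ((integrable_const _).indicator measurableSet_Ici) (integrable_const _),
    integral_indicator measurableSet_Ici, Measure.restrict_restrict measurableSet_Ici]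
  have : Ici (1 / 2 : ℝ) ∩ Icc 0 1 = Icc (1 / 2) 1 := by
    ext x; simp only [mem_inter_iff, mem_Ici, mem_Icc]
    exact ⟨fun h => ⟨h.1, h.2.2⟩, fun h => ⟨h.1, by linarith [h.1], h.2⟩⟩
  rw [this]
  simp
  norm_num
  ring

lemma memGS_stepDensity {K : ℕ} (hK : 0 < K) {τ : ℝ} (hτ : τ ∈ Icc (0:ℝ) 1) {c : Fin K → ℝ}
    (hc : ∀ j, |c j| ≤ 1) :
    memGS τ (covMeasure (stepDensity (2 * τ) (2 * (1 - τ))) (tentEta K c))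
      (covMeasure (stepDensity 2 0) (tentEta K c)) := by
  have hτ1 : 0 ≤ 1 - τ := by linarith [hτ.2]
  refine ⟨_, _, _, stepDensity_nonneg (by linarith [hτ.1]) (by linarith),
    stepDensity_nonneg zero_le_two le_rfl, ?_, ?_, tentEta_mem hK hc, ?_, ?_, ?_, rfl, rfl⟩
  · rw [integral_stepDensity]; ring
  · rw [integral_stepDensity]; norm_num
  · refine LipschitzOnWith.of_dist_le_mul fun x _ y _ => ?_
    simpa [Real.dist_eq] using abs_tentEta_sub_le hK hc x y
  · refine LipschitzOnWith.of_dist_le_mul fun x _ y _ => ?_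
    rw [Real.dist_eq, sub_sub_sub_cancel_left, abs_sub_comm]
    simpa [Real.dist_eq] using abs_tentEta_sub_le hK hc x y
  · have h : (fun x => |stepDensity (2 * τ) (2 * (1 - τ)) x - stepDensity 2 0 x|) =
        stepDensity (2 * (1 - τ)) (2 * (1 - τ)) := by
      ext x
      unfold stepDensity
      split_ifs
      · rw [abs_sub_comm, abs_of_nonneg (by linarith)]; ring
      · rw [sub_zero, abs_of_nonneg (by linarith)]
    rw [tvDist, h, integral_stepDensity]
    linarith

lemma abs_sgnB (b : Bool) : |sgnB b| = 1 := by cases b <;> simp [sgnB]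

/-- The likelihood-ratio perturbation caused by the `j`-th tent. -/
def tentScore (K : ℕ) (j : Fin K) (z : ℝ × Bool) : ℝ := sgnB z.2 * (2 * tent K j z.1)

section Instances

variable {K : ℕ}

lemma measurable_tentScore (j : Fin K) : Measurable (tentScore K j) :=
  ((measurable_of_countable sgnB).comp measurable_snd).mul
    (((measurable_tent j).comp measurable_fst).const_mul 2)

lemma abs_tentScore_le (j : Fin K) (z : ℝ × Bool) : |tentScore K j z| ≤ 1 := by
  rw [tentScore, abs_mul, abs_sgnB, one_mul, abs_of_nonneg (by linarith [tent_nonneg j z.1])]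
  linarith [(tent_le j z.1).trans (one_div_four_mul_le j)]

lemma tentScore_sq (j : Fin K) (z : ℝ × Bool) : tentScore K j z ^ 2 = (2 * tent K j z.1) ^ 2 := by
  rw [tentScore, mul_pow, ← sq_abs (sgnB z.2), abs_sgnB, one_pow, one_mul]

lemma integral_tentScore_sq_le {a b : ℝ} (ha : 0 ≤ a) (hb : 0 ≤ b) (hab : a + b = 2)
    {c : Fin K → ℝ} (hc : ∀ j, |c j| ≤ 1) (j : Fin K) :
    ∫ z, tentScore K j z ^ 2 ∂covMeasure (stepDensity a b) (tentEta K c) ≤ a / (8 * K ^ 3) := by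
  have hK : (0 : ℝ) < K := by exact_mod_cast j.pos
  have h4 : (0 : ℝ) < 1 / (4 * K) := by positivity
  rw [integral_covMeasure (measurable_stepDensity a b) (stepDensity_nonneg ha hb)
    (by rw [integral_stepDensity, hab]; norm_num) (tentEta_mem j.pos hc) (measurable_tentEta c)
    ((measurable_tentScore j).pow_const 2) (C := 1)
    (fun z => by rw [abs_pow]; exact pow_le_one₀ (abs_nonneg _) (abs_tentScore_le j z))]
  set I := Icc (tentCenter K j - 1 / (4 * K)) (tentCenter K j + 1 / (4 * K))
  have hI : volume.real I = 1 / (2 * K) := by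
    rw [Real.volume_real_Icc_of_le (by linarith)]; field_simp; norm_num
  have hfin : volume I ≠ ⊤ := measure_Icc_lt_top.ne
  have key (x : ℝ) : stepDensity a b x * (tentEta K c x * tentScore K j (x, true) ^ 2 +
      (1 - tentEta K c x) * tentScore K j (x, false) ^ 2) ≤
      I.indicator (fun _ => a * (1 / (2 * K)) ^ 2) x := by
    rw [tentScore_sq, tentScore_sq]
    simp only
    rcases (tent_nonneg j x).eq_or_lt with h | h
    · rw [← h]
      simp only [mul_zero, ne_eq, OfNat.ofNat_ne_zero, not_false_eq_true, zero_pow, add_zero]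
      exact indicator_nonneg (fun _ _ => by positivity) _
    · rw [indicator_of_mem (tent_pos_mem h), stepDensity, if_pos (half_le_of_tent_pos h),
        ← add_mul, add_sub_cancel, one_mul]
      have h2 : 2 * tent K j x ≤ 1 / (2 * K) := by
        have := tent_le j x
        have e : 1 / (2 * (K : ℝ)) = 2 * (1 / (4 * K)) := by field_simp; norm_num
        linarith
      gcongr
  have hind : Integrable (I.indicator (fun _ => a * (1 / (2 * (K : ℝ))) ^ 2)) volume :=
    (integrable_indicator_iff measurableSet_Icc).2 (integrableOn_const hfin)
  calc _ ≤ ∫ x in Icc (0:ℝ) 1, I.indicator (fun _ => a * (1 / (2 * (K : ℝ))) ^ 2) x :=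
        integral_mono_of_nonneg (ae_of_all _ fun x => mul_nonneg (stepDensity_nonneg ha hb x)
          (add_nonneg (mul_nonneg (tentEta_mem j.pos hc x).1 (sq_nonneg _))
            (mul_nonneg (by linarith [(tentEta_mem j.pos hc x).2]) (sq_nonneg _))))
          hind.integrableOn (ae_of_all _ key)
    _ ≤ ∫ x, I.indicator (fun _ => a * (1 / (2 * (K : ℝ))) ^ 2) x :=
        setIntegral_le_integral hind
          (ae_of_all _ fun x => indicator_nonneg (fun _ _ => by positivity) _)
    _ = a / (8 * K ^ 3) := by
        rw [integral_indicator_const _ measurableSet_Icc, hI, smul_eq_mul]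
        field_simp; ring

lemma sum_indicator_le_loss_sub {a b : ℝ} (ha : 0 ≤ a) (hb : 0 ≤ b) (hK : 0 < K)
    (v : Fin K → Bool) (f : ℝ → Bool) (x : ℝ) :
    ∑ j, (tentCore K j ∩ {x | f x ≠ v j}).indicator (fun _ => a * (1 / (4 * (K : ℝ)))) x ≤
      stepDensity a b x *
          (if f x then 1 - tentEta K (sgnB ∘ v) x else tentEta K (sgnB ∘ v) x) -
        stepDensity a b x * (if plugIn (tentEta K (sgnB ∘ v)) x then 1 - tentEta K (sgnB ∘ v) x
          else tentEta K (sgnB ∘ v) x) := by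
  have hK' : (0 : ℝ) < K := by exact_mod_cast hK
  have h8 : (0 : ℝ) < 1 / (8 * K) := by positivity
  obtain ⟨j, hj⟩ := exists_tent_eq_zero hK x
  rw [Finset.sum_eq_single j (fun i _ hi => indicator_of_notMem (fun hx => by
    have := le_tent_of_mem_tentCore hx.1
    rw [hj i hi] at this
    linarith) _) (by simp), ← mul_sub]
  have hs := stepDensity_nonneg ha hb x
  have hη : tentEta K (sgnB ∘ v) x = 1 / 2 + sgnB (v j) * tent K j x := tentEta_eq hj _
  by_cases hx : x ∈ tentCore K j ∩ {x | f x ≠ v j}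
  · rw [indicator_of_mem hx, stepDensity, if_pos (tentCore_subset j hx.1).1]
    have ht := le_tent_of_mem_tentCore hx.1
    have e : 1 / (4 * (K : ℝ)) = 2 * (1 / (8 * K)) := by field_simp; norm_num
    refine mul_le_mul_of_nonneg_left ?_ ha
    have hne : f x ≠ v j := hx.2
    rw [e]
    cases hv : v j
    · have h1 : f x = true := by rw [hv] at hne; simpa using hne
      have hη' : tentEta K (sgnB ∘ v) x = 1 / 2 - tent K j x := by rw [hη, hv, sgnB]; simp; ring
      have h2 : plugIn (tentEta K (sgnB ∘ v)) x = false :=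
        decide_eq_false (by rw [not_le, hη']; linarith)
      rw [h1, h2]
      simp only [if_true, Bool.false_eq_true, if_false]
      rw [hη']; linarith
    · have h1 : f x = false := by rw [hv] at hne; simpa using hne
      have hη' : tentEta K (sgnB ∘ v) x = 1 / 2 + tent K j x := by rw [hη, hv, sgnB]; simp
      have h2 : plugIn (tentEta K (sgnB ∘ v)) x = true :=
        decide_eq_true (by rw [hη']; linarith)
      rw [h1, h2]
      simp only [if_true, Bool.false_eq_true, if_false]
      rw [hη']; linarith
  · rw [indicator_of_notMem hx]
    refine mul_nonneg hs ?_
    unfold plugIn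
    by_cases h : 1 / 2 ≤ tentEta K (sgnB ∘ v) x <;> cases f x <;>
      simp only [h, decide_true, decide_false, if_true, if_false, Bool.false_eq_true] <;> linarith

lemma sum_volume_le_risk_sub {a b : ℝ} (ha : 0 ≤ a) (hb : 0 ≤ b) (hab : a + b = 2) (hK : 0 < K)
    (v : Fin K → Bool) {f : ℝ → Bool} (hf : Measurable f) :
    a * (1 / (4 * K)) * ∑ j, (volume.restrict (tentCore K j)).real {x | f x ≠ v j} ≤
      risk f (covMeasure (stepDensity a b) (tentEta K (sgnB ∘ v))) -
        risk (plugIn (tentEta K (sgnB ∘ v)))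
          (covMeasure (stepDensity a b) (tentEta K (sgnB ∘ v))) := by
  have hη := measurable_tentEta (sgnB ∘ v)
  have hmem := tentEta_mem hK (c := sgnB ∘ v) fun j => (abs_sgnB _).le
  have hone : ∫ x in Icc (0:ℝ) 1, stepDensity a b x = 1 := by
    rw [integral_stepDensity, hab]; norm_num
  have hpi : Integrable (stepDensity a b) (volume.restrict (Icc (0:ℝ) 1)) := by
    by_contra h
    rw [integral_undef h] at hone
    exact zero_ne_one hone
  have hloss {g : ℝ → Bool} (hg : Measurable g) : Integrable (fun x => stepDensity a b x *
      (if g x then 1 - tentEta K (sgnB ∘ v) x else tentEta K (sgnB ∘ v) x))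
      (volume.restrict (Icc (0:ℝ) 1)) := by
    refine hpi.mul_bdd (c := 1) (Measurable.ite (hg (measurableSet_singleton true))
      (measurable_const.sub hη) hη).aestronglyMeasurable (ae_of_all _ fun x => ?_)
    rw [Real.norm_eq_abs, abs_le]
    split_ifs <;> constructor <;> linarith [(hmem x).1, (hmem x).2]
  have hset (j : Fin K) : MeasurableSet {x | f x ≠ v j} :=
    (measurableSet_eq_fun hf measurable_const).compl
  have hms (j : Fin K) : MeasurableSet (tentCore K j ∩ {x | f x ≠ v j}) :=
    measurableSet_Icc.inter (hset j)
  rw [risk_covMeasure (measurable_stepDensity a b) (stepDensity_nonneg ha hb) hone hmem hη hf,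
    risk_covMeasure (measurable_stepDensity a b) (stepDensity_nonneg ha hb) hone hmem hη
      (measurable_plugIn hη), ← integral_sub (hloss hf) (hloss (measurable_plugIn hη))]
  have hi (j : Fin K) : Integrable ((tentCore K j ∩ {x | f x ≠ v j}).indicator
      (fun _ => a * (1 / (4 * (K : ℝ))))) (volume.restrict (Icc (0:ℝ) 1)) :=
    (integrable_const _).indicator (hms j)
  calc _ = ∫ x in Icc (0:ℝ) 1, ∑ j, (tentCore K j ∩ {x | f x ≠ v j}).indicator
          (fun _ => a * (1 / (4 * (K : ℝ)))) x := by
        rw [integral_finsetSum _ fun j _ => hi j, Finset.mul_sum]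
        refine Finset.sum_congr rfl fun j _ => ?_
        rw [integral_indicator_const _ (hms j), smul_eq_mul, mul_comm,
          measureReal_restrict_apply (hset j), measureReal_restrict_apply (hms j),
          inter_comm (tentCore K j)]
        congr 2
        refine (inter_eq_left.2 (inter_subset_right.trans fun x hx => ?_)).symm
        have := tentCore_subset j hx
        exact ⟨by linarith [this.1], this.2⟩
    _ ≤ _ := integral_mono (integrable_finsetSum _ fun j _ => hi j)
        ((hloss hf).sub (hloss (measurable_plugIn hη)))
        fun x => sum_indicator_le_loss_sub ha hb hK v f x

end Instances

section Averaging

variable {K nmaj nmin : ℕ} {τ : ℝ}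

/-- The majority law of the tent instance with coefficients `c`. -/
def tentMaj (K : ℕ) (τ : ℝ) (c : Fin K → ℝ) : Measure (ℝ × Bool) :=
  covMeasure (stepDensity (2 * τ) (2 * (1 - τ))) (tentEta K c)

/-- The minority law of the tent instance with coefficients `c`. -/
def tentMin (K : ℕ) (c : Fin K → ℝ) : Measure (ℝ × Bool) :=
  covMeasure (stepDensity 2 0) (tentEta K c)

/-- The law of the sample under the tent instance with sign pattern `v`. -/
def tentLaw (K nmaj nmin : ℕ) (τ : ℝ) (v : Fin K → Bool) : Measure (Sample nmaj nmin) :=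
  sampleMeasure nmaj nmin (tentMaj K τ (sgnB ∘ v)) (tentMin K (sgnB ∘ v))

/-- The size of the set of points in the core of the `j`-th tent not labelled `b` by `A S`. -/
def coreError (A : Sample nmaj nmin → ℝ → Bool) (j : Fin K) (b : Bool)
    (S : Sample nmaj nmin) : ℝ :=
  (volume.restrict (tentCore K j)).real {x | A S x ≠ b}

lemma memGS_tent (hK : 0 < K) (hτ : τ ∈ Icc (0:ℝ) 1) {c : Fin K → ℝ} (hc : ∀ j, |c j| ≤ 1) :
    memGS τ (tentMaj K τ c) (tentMin K c) := memGS_stepDensity hK hτ hc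

lemma MeasurableAlg.measurable_apply {A : Sample nmaj nmin → ℝ → Bool}
    (hA : MeasurableAlg nmaj nmin A) (S : Sample nmaj nmin) : Measurable (A S) :=
  Measurable.comp (g := fun p : Sample nmaj nmin × ℝ => A p.1 p.2) hA measurable_prodMk_left

lemma MeasurableAlg.measurable_coreError {A : Sample nmaj nmin → ℝ → Bool}
    (hA : MeasurableAlg nmaj nmin A) (j : Fin K) (b : Bool) : Measurable (coreError A j b) := by
  have hs : MeasurableSet {p : Sample nmaj nmin × ℝ | A p.1 p.2 ≠ b} :=
    (measurableSet_eq_fun hA measurable_const).compl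
  exact (measurable_measure_prodMk_left hs).ennreal_toReal

lemma MeasurableAlg.measurable_risk {A : Sample nmaj nmin → ℝ → Bool}
    (hA : MeasurableAlg nmaj nmin A) (P : Measure (ℝ × Bool)) [SFinite P] :
    Measurable fun S => risk (A S) P := by
  have hs : MeasurableSet {p : Sample nmaj nmin × ℝ × Bool | A p.1 p.2.1 ≠ p.2.2} :=
    (measurableSet_eq_fun (hA.comp (f := fun p : Sample nmaj nmin × ℝ × Bool => (p.1, p.2.1))
      (by fun_prop)) (by fun_prop)).compl
  exact (measurable_measure_prodMk_left hs).ennreal_toReal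

lemma coreError_nonneg (A : Sample nmaj nmin → ℝ → Bool) (j : Fin K) (b : Bool)
    (S : Sample nmaj nmin) : 0 ≤ coreError A j b S := measureReal_nonneg

lemma coreError_true_add_false {A : Sample nmaj nmin → ℝ → Bool}
    (hA : MeasurableAlg nmaj nmin A) (j : Fin K) (S : Sample nmaj nmin) :
    coreError A j true S + coreError A j false S = 1 / (4 * K) := by
  have hs : MeasurableSet {x | A S x ≠ true} :=
    (measurableSet_eq_fun (hA.measurable_apply S) measurable_const).compl
  have hfin : IsFiniteMeasure (volume.restrict (tentCore K j)) :=
    ⟨by rw [Measure.restrict_apply_univ]; exact measure_Icc_lt_top⟩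
  have he : {x | A S x ≠ false} = {x | A S x ≠ true}ᶜ := by
    ext x; cases h : A S x <;> simp [h]
  rw [coreError, coreError, he, measureReal_add_measureReal_compl hs, ← volume_real_tentCore j]
  simp [Measure.real]

lemma coreError_le {A : Sample nmaj nmin → ℝ → Bool} (hA : MeasurableAlg nmaj nmin A)
    (j : Fin K) (b : Bool) (S : Sample nmaj nmin) : coreError A j b S ≤ 1 / (4 * K) := by
  rw [← coreError_true_add_false hA j S]
  cases b <;> linarith [coreError_nonneg A j true S, coreError_nonneg A j false S]

lemma isProbabilityMeasure_tentLaw (hK : 0 < K) (hτ : τ ∈ Icc (0:ℝ) 1) (v : Fin K → Bool) :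
    IsProbabilityMeasure (tentLaw K nmaj nmin τ v) := by
  have h := memGS_tent hK hτ (c := sgnB ∘ v) fun j => (abs_sgnB _).le
  have := h.isProbabilityMeasure.1
  have := h.isProbabilityMeasure.2
  unfold tentLaw sampleMeasure
  infer_instance

lemma integrable_coreError {A : Sample nmaj nmin → ℝ → Bool} (hA : MeasurableAlg nmaj nmin A)
    (hτ : τ ∈ Icc (0:ℝ) 1) (v : Fin K → Bool) (j : Fin K) (b : Bool) :
    Integrable (coreError A j b) (tentLaw K nmaj nmin τ v) :=
  have := isProbabilityMeasure_tentLaw (nmaj := nmaj) (nmin := nmin) j.pos hτ v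
  Integrable.of_bound (hA.measurable_coreError j b).aestronglyMeasurable (1 / (4 * K))
    (ae_of_all _ fun S => by
      rw [Real.norm_of_nonneg (coreError_nonneg A j b S)]
      exact coreError_le hA j b S)

lemma covMeasure_tentEta_withDensity {p : ℝ → ℝ} (hpm : Measurable p) (hp : ∀ x, 0 ≤ p x)
    (v : Fin K → Bool) (j : Fin K) (b : Bool) :
    (covMeasure p (tentEta K (Function.update (sgnB ∘ v) j 0))).withDensity
        (fun z => ENNReal.ofReal (1 + sgnB b * tentScore K j z)) =
      covMeasure p (tentEta K (sgnB ∘ Function.update v j b)) := by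
  have hc (i : Fin K) : |Function.update (sgnB ∘ v) j 0 i| ≤ 1 := by
    rcases eq_or_ne i j with rfl | h
    · simp
    · rw [Function.update_of_ne h]; exact (abs_sgnB _).le
  rw [Function.comp_update]
  refine covMeasure_withDensity hpm hp (tentEta_mem j.pos hc) (measurable_tentEta _)
    (measurable_const.add ((measurable_tentScore j).const_mul _)) (fun x => ?_) fun x => ?_ <;>
  · have h0 := tentEta_update_zero_mul (sgnB ∘ v) j x
    rw [tentEta_update (sgnB ∘ v) j (sgnB b), tentScore]
    simp only [show sgnB true = 1 from rfl, show sgnB false = -1 from rfl]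
    linear_combination sgnB b * h0

lemma le_integral_coreError_add {A : Sample nmaj nmin → ℝ → Bool}
    (hA : MeasurableAlg nmaj nmin A) (hτ : τ ∈ Icc (0:ℝ) 1) (v : Fin K → Bool) (j : Fin K) :
    1 / (4 * K) * (1 / 2 - (nmin + nmaj * τ) / (4 * K ^ 3)) ≤
      ∫ S, coreError A j true S ∂tentLaw K nmaj nmin τ (Function.update v j true) +
        ∫ S, coreError A j false S ∂tentLaw K nmaj nmin τ (Function.update v j false) := by
  have hK : (0 : ℝ) < K := by exact_mod_cast j.pos
  have h2τ : 0 ≤ 2 * τ := by linarith [hτ.1]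
  have h2τ' : 0 ≤ 2 * (1 - τ) := by linarith [hτ.2]
  set c := Function.update (sgnB ∘ v) j 0 with hcdef
  have hc (i : Fin K) : |c i| ≤ 1 := by
    rcases eq_or_ne i j with rfl | h
    · simp [hcdef]
    · rw [hcdef, Function.update_of_ne h]; exact (abs_sgnB _).le
  have hGS (c : Fin K → ℝ) (hc : ∀ i, |c i| ≤ 1) := (memGS_tent j.pos hτ hc).isProbabilityMeasure
  have e₁ (b : Bool) : (tentMaj K τ c).withDensity
      (fun z => ENNReal.ofReal (1 + sgnB b * tentScore K j z)) =
        tentMaj K τ (sgnB ∘ Function.update v j b) :=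
    covMeasure_tentEta_withDensity (measurable_stepDensity _ _) (stepDensity_nonneg h2τ h2τ') v j b
  have e₂ (b : Bool) : (tentMin K c).withDensity
      (fun z => ENNReal.ofReal (1 + sgnB b * tentScore K j z)) =
        tentMin K (sgnB ∘ Function.update v j b) :=
    covMeasure_tentEta_withDensity (measurable_stepDensity _ _)
      (stepDensity_nonneg zero_le_two le_rfl) v j b
  have e₁t := e₁ true
  have e₁f := e₁ false
  have e₂t := e₂ true
  have e₂f := e₂ false
  simp only [sgnB, if_true, Bool.false_eq_true, if_false, one_mul, neg_one_mul, ← sub_eq_add_neg]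
    at e₁t e₁f e₂t e₂f
  have hs (b : Bool) := hGS (sgnB ∘ Function.update v j b) fun i => (abs_sgnB _).le
  have i₁ := (hGS c hc).1
  have i₂ := (hGS c hc).2
  have i₃ : IsProbabilityMeasure ((tentMaj K τ c).withDensity
      fun z => ENNReal.ofReal (1 + tentScore K j z)) := e₁t ▸ (hs true).1
  have i₄ : IsProbabilityMeasure ((tentMin K c).withDensity
      fun z => ENNReal.ofReal (1 + tentScore K j z)) := e₂t ▸ (hs true).2
  have i₅ : IsProbabilityMeasure ((tentMaj K τ c).withDensity
      fun z => ENNReal.ofReal (1 - tentScore K j z)) := e₁f ▸ (hs false).1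
  have i₆ : IsProbabilityMeasure ((tentMin K c).withDensity
      fun z => ENNReal.ofReal (1 - tentScore K j z)) := e₂f ▸ (hs false).2
  have hone (S : Sample nmaj nmin) :
      1 - 4 * K * coreError A j true S = 4 * K * coreError A j false S := by
    have := coreError_true_add_false hA j S
    field_simp at this
    linarith
  have key := two_point_sampleMeasure nmaj nmin (tentMaj K τ c) (tentMin K c)
    (measurable_tentScore j) (abs_tentScore_le j) (g := fun S => 4 * K * coreError A j true S)
    ((hA.measurable_coreError j true).const_mul _)
    (fun S => mul_nonneg (by positivity) (coreError_nonneg A j true S))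
    (fun S => by
      have h4 : 0 ≤ 4 * K * coreError A j false S :=
        mul_nonneg (by positivity) (coreError_nonneg A j false S)
      linarith [hone S])
  simp_rw [hone, integral_const_mul] at key
  rw [e₁t, e₁f, e₂t, e₂f, ← mul_add] at key
  have b₁ := integral_tentScore_sq_le h2τ h2τ' (by ring) hc j
  have b₂ := integral_tentScore_sq_le zero_le_two le_rfl (by norm_num) hc j
  have hb : (nmin + nmaj * τ) / (4 * (K:ℝ) ^ 3) =
      nmaj * (2 * τ / (8 * K ^ 3)) + nmin * (2 / (8 * K ^ 3)) := by
    field_simp; ring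
  rw [one_div_mul_eq_div, div_le_iff₀' (by positivity), hb]
  refine le_trans ?_ key
  gcongr
  · exact b₁
  · exact b₂

lemma le_excessRisk_tent {A : Sample nmaj nmin → ℝ → Bool} (hA : MeasurableAlg nmaj nmin A)
    (hK : 0 < K) (hτ : τ ∈ Icc (0:ℝ) 1) (v : Fin K → Bool) :
    1 / (4 * K) * ∑ j, ∫ S, coreError A j (v j) S ∂tentLaw K nmaj nmin τ v ≤
      excessRisk nmaj nmin A (tentMaj K τ (sgnB ∘ v)) (tentMin K (sgnB ∘ v)) := by
  have h2τ : 0 ≤ 2 * τ := by linarith [hτ.1]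
  have h2τ' : 0 ≤ 2 * (1 - τ) := by linarith [hτ.2]
  have h := memGS_tent hK hτ (c := sgnB ∘ v) fun j => (abs_sgnB _).le
  have i₁ := h.isProbabilityMeasure.1
  have i₂ := h.isProbabilityMeasure.2
  have i₃ := isProbabilityMeasure_tentLaw (nmaj := nmaj) (nmin := nmin) hK hτ v
  set f := plugIn (tentEta K (sgnB ∘ v))
  set T := testMeasure (tentMaj K τ (sgnB ∘ v)) (tentMin K (sgnB ∘ v)) with hT
  have hpt (S : Sample nmaj nmin) :
      1 / (4 * K) * ∑ j, coreError A j (v j) S + risk f T ≤ risk (A S) T := by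
    have h₁ := sum_volume_le_risk_sub h2τ h2τ' (by ring) hK v (hA.measurable_apply S)
    have h₂ := sum_volume_le_risk_sub zero_le_two le_rfl (by norm_num) hK v (hA.measurable_apply S)
    have h₀ : 0 ≤ 2 * τ * (1 / (4 * K)) * ∑ j, coreError A j (v j) S :=
      mul_nonneg (by positivity) (Finset.sum_nonneg fun j _ => coreError_nonneg A j _ S)
    have h₃ := h₀.trans h₁
    rw [hT, risk_testMeasure, risk_testMeasure]
    change 2 * (1 / (4 * (K:ℝ))) * ∑ j, coreError A j (v j) S ≤
      risk (A S) (tentMin K (sgnB ∘ v)) - risk f (tentMin K (sgnB ∘ v)) at h₂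
    change 0 ≤ risk (A S) (tentMaj K τ (sgnB ∘ v)) - risk f (tentMaj K τ (sgnB ∘ v)) at h₃
    linarith
  have hr (P : Measure (ℝ × Bool)) [IsProbabilityMeasure P] :
      Integrable (fun S => risk (A S) P) (tentLaw K nmaj nmin τ v) :=
    Integrable.of_bound (hA.measurable_risk P).aestronglyMeasurable 1 (ae_of_all _ fun S => by
      rw [risk, Real.norm_of_nonneg ENNReal.toReal_nonneg]
      exact measureReal_le_one)
  have hrT : Integrable (fun S => risk (A S) T) (tentLaw K nmaj nmin τ v) := by
    simp_rw [hT, risk_testMeasure]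
    exact ((hr _).add (hr _)).div_const 2
  have hsum : Integrable (fun S => ∑ j, coreError A j (v j) S) (tentLaw K nmaj nmin τ v) :=
    integrable_finsetSum _ fun j _ => integrable_coreError hA hτ v j (v j)
  have hint := integral_mono ((hsum.const_mul (1 / (4 * K))).add (integrable_const (risk f T)))
    hrT hpt
  simp only [Pi.add_apply] at hint
  rw [integral_add (hsum.const_mul _) (integrable_const _), integral_const_mul,
    integral_finsetSum _ fun j _ => integrable_coreError hA hτ v j (v j), integral_const,
    probReal_univ, one_smul] at hint
  have hbayes := bayesRisk_le_risk f T
  change _ ≤ ∫ S, risk (A S) T ∂tentLaw K nmaj nmin τ v - bayesRisk T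
  linarith

lemma sum_update_not {ι : Type*} [Fintype ι] [DecidableEq ι] (j : ι) (F : (ι → Bool) → ℝ) :
    ∑ v, (F (Function.update v j true) + F (Function.update v j false)) = 2 * ∑ v, F v := by
  have hinv : Function.Involutive fun v : ι → Bool => Function.update v j (!v j) := fun v => by
    simp
  have h := Equiv.sum_comp hinv.toPerm F
  rw [two_mul]
  nth_rw 2 [← h]
  rw [← Finset.sum_add_distrib]
  refine Finset.sum_congr rfl fun v _ => ?_
  have e : Function.update v j (v j) = v := Function.update_eq_self j v
  change _ = F v + F (Function.update v j (!v j))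
  cases hv : v j <;> rw [hv] at e <;> simp [e, add_comm]

lemma le_iSup_excessRisk {A : Sample nmaj nmin → ℝ → Bool} (hA : MeasurableAlg nmaj nmin A)
    (hK : 0 < K) (hτ : τ ∈ Icc (0:ℝ) 1) :
    (1 / 2 - (nmin + nmaj * τ) / (4 * K ^ 3)) / (32 * K) ≤
      ⨆ P : {P : Measure (ℝ × Bool) × Measure (ℝ × Bool) // memGS τ P.1 P.2},
        excessRisk nmaj nmin A P.1.1 P.1.2 := by
  have hK' : (0 : ℝ) < K := by exact_mod_cast hK
  set R := ⨆ P : {P : Measure (ℝ × Bool) × Measure (ℝ × Bool) // memGS τ P.1 P.2},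
    excessRisk nmaj nmin A P.1.1 P.1.2
  set F : (Fin K → Bool) → Fin K → ℝ :=
    fun v j => ∫ S, coreError A j (v j) S ∂tentLaw K nmaj nmin τ v
  set B : ℝ := 1 / (4 * K) * (1 / 2 - (nmin + nmaj * τ) / (4 * K ^ 3))
  obtain ⟨N, hNdef⟩ : ∃ N : ℝ, N = (Fintype.card (Fin K → Bool) : ℕ) := ⟨_, rfl⟩
  have hN : 0 < N := by rw [hNdef]; exact_mod_cast Fintype.card_pos
  have hR (v : Fin K → Bool) : 1 / (4 * K) * ∑ j, F v j ≤ R :=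
    (le_excessRisk_tent hA hK hτ v).trans
      (le_ciSup (bddAbove_excessRisk nmaj nmin τ A)
        ⟨(tentMaj K τ (sgnB ∘ v), tentMin K (sgnB ∘ v)),
          memGS_tent hK hτ fun j => (abs_sgnB _).le⟩)
  have hF (j : Fin K) : N * (B / 2) ≤ ∑ v, F v j := by
    have h : ∑ _v : Fin K → Bool, B ≤ ∑ v, (F (Function.update v j true) j +
        F (Function.update v j false) j) := Finset.sum_le_sum fun v _ => by
      have := le_integral_coreError_add hA hτ v j
      simpa only [F, Function.update_self] using this
    rw [sum_update_not j fun v => F v j, Finset.sum_const, nsmul_eq_mul,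
      Finset.card_univ, ← hNdef] at h
    linarith
  have h₁ : ∑ v, 1 / (4 * K) * ∑ j, F v j ≤ N * R := by
    refine (Finset.sum_le_sum fun v _ => hR v).trans_eq ?_
    rw [Finset.sum_const, nsmul_eq_mul, Finset.card_univ, ← hNdef]
  have h₂ : K * (N * (B / 2)) ≤ ∑ j, ∑ v, F v j := by
    refine Eq.trans_le ?_ (Finset.sum_le_sum fun j _ => hF j)
    simp
  rw [← Finset.mul_sum, Finset.sum_comm] at h₁
  have h₃ : N * (1 / (4 * K) * (K * (B / 2))) ≤ N * R := by
    refine le_trans ?_ h₁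
    rw [show N * (1 / (4 * K) * (K * (B / 2))) = 1 / (4 * K) * (K * (N * (B / 2))) by ring]
    gcongr
  refine Eq.trans_le ?_ (le_of_mul_le_mul_left h₃ hN)
  simp only [B]
  field_simp
  ring

end Averaging

lemma exists_nat_bound {s : ℝ} (hs : 1 ≤ s) :
    ∃ K : ℕ, 0 < K ∧ 1 / (200 * s) ≤ (1 / 2 - s ^ 3 / (4 * K ^ 3)) / (32 * K) := by
  refine ⟨⌈s⌉₊, Nat.ceil_pos.2 (by linarith), ?_⟩
  have h₁ : s ≤ ⌈s⌉₊ := Nat.le_ceil s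
  have h₂ : (⌈s⌉₊ : ℝ) ≤ 2 * s := by linarith [Nat.ceil_lt_add_one (by linarith : 0 ≤ s)]
  generalize (⌈s⌉₊ : ℝ) = k at h₁ h₂ ⊢
  have hk : 0 < k := by linarith
  obtain ⟨u, rfl⟩ : ∃ u, s = u * k := ⟨s / k, by field_simp⟩
  have hu : 1 / 2 ≤ u := by
    by_contra! h
    nlinarith
  have hu1 : u ≤ 1 := by
    by_contra! h
    nlinarith
  rw [div_le_div_iff₀ (by positivity) (by positivity)]
  have e : (1 / 2 - (u * k) ^ 3 / (4 * k ^ 3)) * (200 * (u * k)) =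
      k * (100 * u - 50 * u ^ 4) := by
    field_simp
    ring
  rw [e]
  have h4 : u ^ 4 ≤ u ^ 2 := pow_le_pow_of_le_one (by linarith) hu1 (by norm_num)
  nlinarith [mul_nonneg (sub_nonneg.2 hu) (sub_nonneg.2 hu1)]

/-- **Theorem (group-covariate shift minimax lower bound).** For `n_min ≥ 1`,
`n_maj > n_min` and `τ ∈ [0,1]`, every measurable algorithm has worst-case excess risk
over `𝒫_GS(τ)` at least `1/(200 (n_min (2-τ) + n_maj τ)^{1/3})`, and consequently
(with `ρ = n_maj/n_min`) at least `1/(200 n_min^{1/3} (ρ τ + 2)^{1/3})`. -/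
theorem group_shift_minimax_lower_bound
    (nmaj nmin : ℕ) (hmin : 1 ≤ nmin) (hmaj : nmin < nmaj)
    (τ : ℝ) (hτ : τ ∈ Icc (0:ℝ) 1)
    (A : Sample nmaj nmin → ℝ → Bool) (hA : MeasurableAlg nmaj nmin A) :
    1 / (200 * ((nmin : ℝ) * (2 - τ) + (nmaj : ℝ) * τ) ^ ((1:ℝ)/3)) ≤
      (⨆ P : {P : Measure (ℝ × Bool) × Measure (ℝ × Bool) // memGS τ P.1 P.2},
        excessRisk nmaj nmin A P.1.1 P.1.2) ∧
    1 / (200 * (nmin : ℝ) ^ ((1:ℝ)/3) * (((nmaj : ℝ)/(nmin : ℝ)) * τ + 2) ^ ((1:ℝ)/3)) ≤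
      (⨆ P : {P : Measure (ℝ × Bool) × Measure (ℝ × Bool) // memGS τ P.1 P.2},
        excessRisk nmaj nmin A P.1.1 P.1.2) := by
  have hmin' : (1:ℝ) ≤ nmin := by exact_mod_cast hmin
  have hmaj0 : (0:ℝ) ≤ nmaj := nmaj.cast_nonneg
  have hpos : 0 ≤ nmaj * τ := mul_nonneg hmaj0 hτ.1
  set n : ℝ := nmin + nmaj * τ with hn
  have hn1 : 1 ≤ n := by linarith
  have hs : 1 ≤ n ^ ((1:ℝ)/3) := Real.one_le_rpow hn1 (by norm_num)
  have hs3 : (n ^ ((1:ℝ)/3)) ^ 3 = n := by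
    rw [← Real.rpow_natCast, ← Real.rpow_mul (by linarith)]
    norm_num
  obtain ⟨K, hK, hb⟩ := exists_nat_bound hs
  rw [hs3] at hb
  have hR := hb.trans (le_iSup_excessRisk hA hK hτ)
  have hle {m : ℝ} (hm : n ≤ m) : 1 / (200 * m ^ ((1:ℝ)/3)) ≤ 1 / (200 * n ^ ((1:ℝ)/3)) := by
    gcongr
  refine ⟨(hle ?_).trans hR, ?_⟩
  · nlinarith [hτ.2]
  · have he : (nmin : ℝ) ^ ((1:ℝ)/3) * (((nmaj : ℝ)/(nmin : ℝ)) * τ + 2) ^ ((1:ℝ)/3) =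
        (nmaj * τ + 2 * nmin) ^ ((1:ℝ)/3) := by
      have hρ : 0 ≤ (nmaj : ℝ) / nmin * τ := mul_nonneg (by positivity) hτ.1
      rw [← Real.mul_rpow (by positivity) (by positivity)]
      congr 1
      field_simp
    rw [mul_assoc, he]
    exact (hle (by linarith)).trans hR
end
end

section
/- There exist absolute constants c, C > 0 such that for every (P_maj, P_min) ∈ P_LS, the expected excess risk of the undersampled binning estimator A_USB with K = c·⌈n_min^{1/3}⌉ bins satisfies E_{S ~ P_maj^{n_maj} × P_min^{n_min}}[R(A_USB^S; P_test) − R(f*; P_test)] ≤ C/n_min^{1/3}. -/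
open MeasureTheory Set
open scoped ENNReal Classical

noncomputable section

open ProbabilityTheory in
/-- The mean absolute deviation of a sum of i.i.d. bounded terms is at most the root of the sum of
the second moments. -/
lemma integral_abs_sum_sub_le {α : Type*} [MeasurableSpace α] {P : Measure α}
    [IsProbabilityMeasure P] {φ : α → ℝ} (hφ : Measurable φ) (hb : ∀ x, |φ x| ≤ 1)
    {N : ℕ} (s : Finset (Fin N)) :
    Integrable (fun ω : Fin N → α => |∑ i ∈ s, φ (ω i) - s.card * ∫ x, φ x ∂P|)
        (Measure.pi fun _ => P) ∧
      ∫ ω : Fin N → α, |∑ i ∈ s, φ (ω i) - s.card * ∫ x, φ x ∂P| ∂(Measure.pi fun _ => P) ≤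
        √(s.card * ∫ x, φ x ^ 2 ∂P) := by
  set μ : Measure (Fin N → α) := Measure.pi fun _ => P
  set m := ∫ x, φ x ∂P
  have hL : MemLp φ 2 P := MemLp.of_bound hφ.aestronglyMeasurable 1 (.of_forall hb)
  have hLi (i : Fin N) : MemLp (fun ω : Fin N → α => φ (ω i)) 2 μ :=
    hL.comp_measurePreserving (measurePreserving_eval _ i)
  have hS : MemLp (fun ω : Fin N → α => ∑ i ∈ s, φ (ω i)) 2 μ :=
    memLp_finsetSum s fun i _ => hLi i
  have hmean : ∫ ω, ∑ i ∈ s, φ (ω i) ∂μ = s.card * m := by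
    rw [integral_finsetSum s fun i _ => (hLi i).integrable (by norm_num)]
    have hi (i : Fin N) : ∫ ω, φ (ω i) ∂μ = m :=
      integral_comp_eval (μ := fun _ : Fin N => P) hφ.aestronglyMeasurable
    simp [hi]
  have hvar : Var[fun ω => ∑ i ∈ s, φ (ω i); μ] ≤ s.card * ∫ x, φ x ^ 2 ∂P := by
    have hsum := IndepFun.variance_sum (s := s) (X := fun i (ω : Fin N → α) => φ (ω i)) (μ := μ)
      (fun i _ => hLi i) fun i _ j _ hij =>
        (iIndepFun_pi (X := fun _ : Fin N => φ) fun _ => hφ.aemeasurable).indepFun hij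
    have hfun : (∑ i ∈ s, fun ω : Fin N → α => φ (ω i)) = fun ω => ∑ i ∈ s, φ (ω i) := by
      ext ω; simp
    rw [hfun] at hsum
    rw [hsum, ← nsmul_eq_mul]
    refine Finset.sum_le_card_nsmul _ _ _ fun i _ => ?_
    rw [(measurePreserving_eval (fun _ : Fin N => P) i).variance_fun_comp hφ.aemeasurable]
    exact variance_le_expectation_sq hφ.aestronglyMeasurable
  have hW : MemLp (fun ω : Fin N → α => |∑ i ∈ s, φ (ω i) - s.card * m|) 2 μ :=
    (hS.sub (memLp_const _)).norm
  refine ⟨hW.integrable (by norm_num), Real.le_sqrt_of_sq_le ?_⟩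
  have h0 := variance_nonneg (fun ω : Fin N → α => |∑ i ∈ s, φ (ω i) - s.card * m|) μ
  rw [variance_eq_sub hW] at h0
  rw [variance_eq_integral hS.aemeasurable, hmean] at hvar
  simp only [Pi.pow_apply, sq_abs] at h0
  linarith

/-- The law on `ℝ` with density `p` on `[0,1]`. -/
def featureMeasure (p : ℝ → ℝ) : Measure ℝ :=
  (volume.restrict (Icc (0:ℝ) 1)).withDensity fun x => ENNReal.ofReal (p x)

/-- The bin `[j/K, (j+1)/K)`. -/
def bin (K j : ℕ) : Set ℝ := Ico ((j:ℝ)/(K:ℝ)) (((j:ℝ)+1)/(K:ℝ))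

lemma measurableSet_bin (K j : ℕ) : MeasurableSet (bin K j) := measurableSet_Ico

lemma labelMeasure_eq_map (p : ℝ → ℝ) (y : Bool) :
    labelMeasure p y = (featureMeasure p).map fun x => (x, y) := rfl

lemma labelMeasure_apply (p : ℝ → ℝ) (y : Bool) {T : Set (ℝ × Bool)} (hT : MeasurableSet T) :
    labelMeasure p y T = featureMeasure p {x | (x, y) ∈ T} := by
  rw [labelMeasure_eq_map, Measure.map_apply (by fun_prop) hT]
  rfl

lemma labelMeasure_congr {p q : ℝ → ℝ} (h : ∀ x ∈ Icc (0:ℝ) 1, p x = q x) (y : Bool) :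
    labelMeasure p y = labelMeasure q y := by
  unfold labelMeasure
  congr 1
  refine withDensity_congr_ae ?_
  filter_upwards [ae_restrict_mem measurableSet_Icc] with x hx
  rw [h x hx]

lemma featureMeasure_real {p : ℝ → ℝ} (hc : Continuous p) (h0 : ∀ x, 0 ≤ p x) {A : Set ℝ}
    (hA : MeasurableSet A) : (featureMeasure p).real A = ∫ x in A ∩ Icc 0 1, p x := by
  rw [measureReal_def, featureMeasure, withDensity_apply _ hA, Measure.restrict_restrict hA,
    integral_eq_lintegral_of_nonneg_ae (.of_forall h0) hc.aestronglyMeasurable]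

lemma isFiniteMeasure_featureMeasure {p : ℝ → ℝ} (hc : Continuous p) :
    IsFiniteMeasure (featureMeasure p) :=
  isFiniteMeasure_withDensity_ofReal (hc.integrableOn_Icc.2)

lemma isProbabilityMeasure_featureMeasure {p : ℝ → ℝ} (hc : Continuous p) (h0 : ∀ x, 0 ≤ p x)
    (h1 : ∫ x in Icc (0:ℝ) 1, p x = 1) : IsProbabilityMeasure (featureMeasure p) := by
  have := isFiniteMeasure_featureMeasure hc
  have h := featureMeasure_real hc h0 MeasurableSet.univ
  rw [univ_inter, h1, measureReal_def, ENNReal.toReal_eq_one_iff] at h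
  exact ⟨h⟩

lemma bin_subset_Icc {K j : ℕ} (hj : j < K) : bin K j ⊆ Icc 0 1 := by
  have hK : (0:ℝ) < K := by exact_mod_cast (Nat.zero_le j).trans_lt hj
  have hj' : (j:ℝ) + 1 ≤ K := by exact_mod_cast hj
  rintro x ⟨hx1, hx2⟩
  exact ⟨le_trans (by positivity) hx1, hx2.le.trans ((div_le_one hK).2 hj')⟩

lemma featureMeasure_real_bin {p : ℝ → ℝ} (hc : Continuous p) (h0 : ∀ x, 0 ≤ p x) {K j : ℕ}
    (hj : j < K) :
    (featureMeasure p).real (bin K j) = ∫ x in (j:ℝ)/K..((j:ℝ)+1)/K, p x := by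
  rw [featureMeasure_real hc h0 (measurableSet_bin K j), inter_eq_left.2 (bin_subset_Icc hj),
    intervalIntegral.integral_of_le (by gcongr; linarith), ← integral_Ico_eq_integral_Ioc]
  rfl

lemma sum_featureMeasure_real_bin {p : ℝ → ℝ} (hc : Continuous p) (h0 : ∀ x, 0 ≤ p x) {K : ℕ}
    (hK : 0 < K) :
    ∑ j ∈ Finset.range K, (featureMeasure p).real (bin K j) = ∫ x in Icc (0:ℝ) 1, p x := by
  rw [Finset.sum_congr rfl fun j hj => featureMeasure_real_bin hc h0 (Finset.mem_range.1 hj)]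
  have h := intervalIntegral.sum_integral_adjacent_intervals (f := p) (μ := volume)
    (a := fun j : ℕ => (j:ℝ)/K) (n := K) fun k _ => hc.intervalIntegrable _ _
  have hK' : (K:ℝ) ≠ 0 := by positivity
  simp only [Nat.cast_add, Nat.cast_one, Nat.cast_zero, zero_div, div_self hK'] at h
  rw [h, intervalIntegral.integral_of_le zero_le_one, integral_Icc_eq_integral_Ioc]

/-- The mass of `min p q` on a bin, for 1-Lipschitz `p` and `q`. -/
lemma min_featureMeasure_real_bin_le {p q : ℝ → ℝ} (hpc : Continuous p) (hqc : Continuous q)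
    (hp0 : ∀ x, 0 ≤ p x) (hq0 : ∀ x, 0 ≤ q x) (hp : ∀ x y, |p x - p y| ≤ |x - y|)
    (hq : ∀ x y, |q x - q y| ≤ |x - y|) {K j : ℕ} (hj : j < K) :
    min ((featureMeasure p).real (bin K j)) ((featureMeasure q).real (bin K j)) ≤
      (featureMeasure fun x => min (p x) (q x)).real (bin K j) + 2 / (K:ℝ) ^ 2 := by
  have hK : (0:ℝ) < K := by exact_mod_cast (Nat.zero_le j).trans_lt hj
  set u : ℝ := (j:ℝ)/K with hu
  set v : ℝ := ((j:ℝ)+1)/K with hv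
  have huv : v - u = 1 / K := by rw [hu, hv]; ring
  have hle : u ≤ v := sub_nonneg.1 (huv ▸ by positivity)
  have key {f g : ℝ → ℝ} (hfc : Continuous f) (hgc : Continuous g)
      (hf : ∀ x y, |f x - f y| ≤ |x - y|) (hg : ∀ x y, |g x - g y| ≤ |x - y|)
      (hfg : f u ≤ g u) :
      ∫ x in u..v, f x ≤ (∫ x in u..v, min (f x) (g x)) + 2 / (K:ℝ) ^ 2 := by
    have hmono : ∫ x in u..v, f x ≤ ∫ x in u..v, (min (f x) (g x) + 2 / K) := by
      refine intervalIntegral.integral_mono_on hle (hfc.intervalIntegrable _ _)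
        (((hfc.min hgc).add continuous_const).intervalIntegrable _ _) fun x hx => ?_
      have hxu : |x - u| ≤ 1 / K := by
        rw [abs_of_nonneg (by linarith [hx.1])]; linarith [hx.2]
      have h1 := abs_le.1 ((hf x u).trans hxu)
      have h2 := abs_le.1 ((hg x u).trans hxu)
      have h3 : (2:ℝ) / K = 1 / K + 1 / K := by ring
      have h4 : 0 < 1 / (K:ℝ) := by positivity
      rw [h3, ← sub_le_iff_le_add]
      exact le_min (by linarith) (by linarith [h1.2, h2.1])
    rw [intervalIntegral.integral_add ((hfc.min hgc).intervalIntegrable _ _)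
      (continuous_const.intervalIntegrable _ _), intervalIntegral.integral_const, huv] at hmono
    refine hmono.trans (le_of_eq ?_)
    rw [smul_eq_mul]; ring
  rw [featureMeasure_real_bin hpc hp0 hj, featureMeasure_real_bin hqc hq0 hj,
    featureMeasure_real_bin (hpc.min hqc) (fun x => le_min (hp0 x) (hq0 x)) hj]
  rcases le_total (p u) (q u) with h | h
  · exact (min_le_left _ _).trans (key hpc hqc hp hq h)
  · simp_rw [min_comm (p _)]
    exact (min_le_right _ _).trans (key hqc hpc hq hp h)

lemma testMeasure_apply_toReal (P Q : Measure (ℝ × Bool)) [IsFiniteMeasure P] [IsFiniteMeasure Q]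
    (T : Set (ℝ × Bool)) :
    (testMeasure P Q T).toReal = (P.real T + Q.real T) / 2 := by
  simp only [testMeasure, Measure.add_apply, Measure.smul_apply, smul_eq_mul]
  rw [ENNReal.toReal_add (by finiteness) (by finiteness)]
  simp [measureReal_def]
  ring

/-- The Bayes risk is at least half the overlap of the two class densities. -/
lemma half_overlap_le_bayesRisk {p q : ℝ → ℝ} (hp : Continuous p) (hq : Continuous q) :
    (featureMeasure fun x => min (p x) (q x)).real univ / 2 ≤
      bayesRisk (testMeasure (labelMeasure p true) (labelMeasure q false)) := by
  have := isFiniteMeasure_featureMeasure hp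
  have := isFiniteMeasure_featureMeasure hq
  have := isFiniteMeasure_featureMeasure (hp.min hq)
  have : IsFiniteMeasure (labelMeasure p true) := by rw [labelMeasure_eq_map]; infer_instance
  have : IsFiniteMeasure (labelMeasure q false) := by rw [labelMeasure_eq_map]; infer_instance
  have hmp : featureMeasure (fun x => min (p x) (q x)) ≤ featureMeasure p :=
    withDensity_mono (.of_forall fun x => ENNReal.ofReal_le_ofReal (min_le_left _ _))
  have hmq : featureMeasure (fun x => min (p x) (q x)) ≤ featureMeasure q :=
    withDensity_mono (.of_forall fun x => ENNReal.ofReal_le_ofReal (min_le_right _ _))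
  refine le_ciInf fun f => ?_
  rw [risk, ← measure_toMeasurable]
  set T := toMeasurable (testMeasure (labelMeasure p true) (labelMeasure q false))
    {x : ℝ × Bool | f x.1 ≠ x.2} with hTdef
  have hT : MeasurableSet T := measurableSet_toMeasurable _ _
  have hsub : {x : ℝ × Bool | f x.1 ≠ x.2} ⊆ T := subset_toMeasurable _ _
  rw [testMeasure_apply_toReal]
  have h1 : (labelMeasure p true).real T = (featureMeasure p).real {x | (x, true) ∈ T} := by
    rw [measureReal_def, labelMeasure_apply _ _ hT, measureReal_def]
  have h2 : (labelMeasure q false).real T = (featureMeasure q).real {x | (x, false) ∈ T} := by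
    rw [measureReal_def, labelMeasure_apply _ _ hT, measureReal_def]
  rw [h1, h2]
  have hcover : (univ : Set ℝ) ⊆ {x | (x, true) ∈ T} ∪ {x | (x, false) ∈ T} := by
    intro x _
    cases hfx : f x
    · exact Or.inl (hsub (by simp [hfx]))
    · exact Or.inr (hsub (by simp [hfx]))
  have h3 := (measureReal_mono (μ := featureMeasure fun x => min (p x) (q x)) hcover).trans
    (measureReal_union_le _ _)
  have h4 : (featureMeasure fun x => min (p x) (q x)).real {x | (x, true) ∈ T} ≤
      (featureMeasure p).real {x | (x, true) ∈ T} :=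
    ENNReal.toReal_mono (measure_ne_top _ _) (hmp _)
  have h5 : (featureMeasure fun x => min (p x) (q x)).real {x | (x, false) ∈ T} ≤
      (featureMeasure q).real {x | (x, false) ∈ T} :=
    ENNReal.toReal_mono (measure_ne_top _ _) (hmq _)
  linarith

/-- Up to the null set `{1}`, a point of `[0,1]` lies in the bin of index `⌊x K⌋ < K`. -/
lemma ae_mem_bin_floor (p : ℝ → ℝ) {K : ℕ} (hK : 0 < K) :
    ∀ᵐ x ∂featureMeasure p,
      min ⌊x * (K:ℝ)⌋₊ (K - 1) < K ∧ x ∈ bin K (min ⌊x * (K:ℝ)⌋₊ (K - 1)) := by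
  have hK' : (0:ℝ) < K := by exact_mod_cast hK
  refine (withDensity_absolutelyContinuous (volume.restrict (Icc (0:ℝ) 1)) _).ae_le ?_
  rw [← Measure.restrict_congr_set Ico_ae_eq_Icc]
  filter_upwards [ae_restrict_mem measurableSet_Ico] with x hx
  have h0 : 0 ≤ x * K := mul_nonneg hx.1 hK'.le
  have hlt : ⌊x * (K:ℝ)⌋₊ < K := (Nat.floor_lt h0).2 (by nlinarith [hx.2])
  rw [min_eq_left (by omega)]
  exact ⟨hlt, (div_le_iff₀ hK').2 (Nat.floor_le h0), (lt_div_iff₀ hK').2 (Nat.lt_floor_add_one _)⟩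

/-- The risk of a classifier constant on the bins is at most the sum of the bin errors. -/
lemma risk_binClassifier_le {p q : ℝ → ℝ} (hp : Continuous p) (hq : Continuous q) {K : ℕ}
    (hK : 0 < K) (g : ℕ → Bool) :
    risk (fun x => g (min ⌊x * (K:ℝ)⌋₊ (K - 1)))
        (testMeasure (labelMeasure p true) (labelMeasure q false)) ≤
      (∑ j ∈ Finset.range K, if g j then (featureMeasure q).real (bin K j)
        else (featureMeasure p).real (bin K j)) / 2 := by
  have := isFiniteMeasure_featureMeasure hp
  have := isFiniteMeasure_featureMeasure hq
  have : IsFiniteMeasure (labelMeasure p true) := by rw [labelMeasure_eq_map]; infer_instance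
  have : IsFiniteMeasure (labelMeasure q false) := by rw [labelMeasure_eq_map]; infer_instance
  have hg : Measurable fun x : ℝ => g (min ⌊x * (K:ℝ)⌋₊ (K - 1)) :=
    (measurable_from_top (f := fun m : ℕ => g (min m (K - 1)))).comp
      (Nat.measurable_floor.comp (measurable_id.mul_const _))
  have hT : MeasurableSet {x : ℝ × Bool | g (min ⌊x.1 * (K:ℝ)⌋₊ (K - 1)) ≠ x.2} :=
    (measurableSet_eq_fun (hg.comp measurable_fst) measurable_snd).compl
  have key {r : ℝ → ℝ} (hr : Continuous r) (y : Bool) :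
      (labelMeasure r y).real {x : ℝ × Bool | g (min ⌊x.1 * (K:ℝ)⌋₊ (K - 1)) ≠ x.2} ≤
        ∑ j ∈ Finset.range K, if g j ≠ y then (featureMeasure r).real (bin K j) else 0 := by
    have := isFiniteMeasure_featureMeasure hr
    rw [measureReal_def, labelMeasure_apply _ _ hT, ← measureReal_def, ← Finset.sum_filter]
    refine le_trans ?_ (measureReal_biUnion_finset_le _ _)
    refine ENNReal.toReal_mono (measure_ne_top _ _) (measure_mono_ae ?_)
    filter_upwards [ae_mem_bin_floor r hK] with x hx hxg
    exact mem_biUnion (Finset.mem_filter.2 ⟨Finset.mem_range.2 hx.1, hxg⟩) hx.2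
  rw [risk, testMeasure_apply_toReal]
  have hsum := add_le_add (key hp true) (key hq false)
  rw [← Finset.sum_add_distrib] at hsum
  refine (div_le_div_iff_of_pos_right two_pos).2 (hsum.trans_eq (Finset.sum_congr rfl fun j _ => ?_))
  cases g j <;> simp

/-- The signed indicator `±1{x ∈ I_j}` of a labelled example. -/
def binSign (K j : ℕ) (z : ℝ × Bool) : ℝ := (bin K j).indicator (fun _ => sgnB z.2) z.1

lemma measurable_binSign (K j : ℕ) : Measurable (binSign K j) := by
  have h : Measurable fun z : ℝ × Bool => sgnB z.2 := (measurable_of_finite sgnB).comp measurable_snd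
  exact h.indicator (measurable_fst (measurableSet_bin K j))

lemma abs_binSign_le (K j : ℕ) (z : ℝ × Bool) : |binSign K j z| ≤ 1 := by
  unfold binSign indicator sgnB
  split_ifs <;> simp

lemma integral_binSign (p : ℝ → ℝ) (y : Bool) (K j : ℕ) :
    ∫ z, binSign K j z ∂labelMeasure p y = (featureMeasure p).real (bin K j) * sgnB y := by
  rw [labelMeasure_eq_map, integral_map (by fun_prop) (measurable_binSign K j).aestronglyMeasurable]
  simp only [binSign]
  rw [integral_indicator_const _ (measurableSet_bin K j), smul_eq_mul]

lemma integral_binSign_sq (p : ℝ → ℝ) (y : Bool) (K j : ℕ) :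
    ∫ z, binSign K j z ^ 2 ∂labelMeasure p y = (featureMeasure p).real (bin K j) := by
  rw [labelMeasure_eq_map,
    integral_map (by fun_prop) ((measurable_binSign K j).pow_const 2).aestronglyMeasurable]
  have h (x : ℝ) : binSign K j (x, y) ^ 2 = (bin K j).indicator 1 x := by
    unfold binSign indicator sgnB
    split_ifs <;> simp
  simp only [h]
  exact integral_indicator_one (measurableSet_bin K j)

lemma sum_binSign {ι : Type*} (s : Finset ι) (w : ι → ℝ × Bool) (K j : ℕ) :
    ∑ i ∈ s, binSign K j (w i) =
      ((s.filter fun i => (w i).2 = true ∧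
        (w i).1 ∈ Ico ((j:ℝ)/(K:ℝ)) (((j:ℝ)+1)/(K:ℝ))).card : ℝ) -
      ((s.filter fun i => (w i).2 = false ∧
        (w i).1 ∈ Ico ((j:ℝ)/(K:ℝ)) (((j:ℝ)+1)/(K:ℝ))).card : ℝ) := by
  rw [Finset.card_filter, Finset.card_filter]
  push_cast
  rw [← Finset.sum_sub_distrib]
  refine Finset.sum_congr rfl fun i _ => ?_
  unfold binSign indicator sgnB bin
  by_cases h : (w i).1 ∈ Ico ((j:ℝ)/(K:ℝ)) (((j:ℝ)+1)/(K:ℝ)) <;> cases (w i).2 <;> simp [h]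

lemma usbBinPred_eq_true_iff (nmaj nmin K : ℕ) (s : Finset (Fin nmaj)) (S : Sample nmaj nmin)
    (j : ℕ) : usbBinPred nmaj nmin K s S j = true ↔
      0 < ∑ i ∈ s, binSign K j (S.1 i) + ∑ i, binSign K j (S.2 i) := by
  rw [sum_binSign s S.1, sum_binSign Finset.univ S.2, usbBinPred, decide_eq_true_iff,
    ← Nat.cast_lt (α := ℝ)]
  push_cast
  constructor <;> intro h <;> linarith

/-- A wrong majority vote costs at most the deviation of the vote from its mean. -/
lemma ite_le_min_add_deviation {P : Prop} [Decidable P] {a b n X Y : ℝ} (hn : 0 < n)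
    (hP : P ↔ 0 < X + Y) :
    (if P then b else a) ≤ min a b + (|X - n * a| + |Y - -(n * b)|) / n := by
  rw [← sub_le_iff_le_add', le_div_iff₀ hn]
  have h1 := neg_abs_le (X - n * a)
  have h2 := le_abs_self (X - n * a)
  have h3 := neg_abs_le (Y - -(n * b))
  have h4 := le_abs_self (Y - -(n * b))
  rcases le_total a b with hab | hab <;> split_ifs with h <;> simp only [hab, min_eq_left, min_eq_right]
  · have := hP.1 h
    linarith
  · linarith [abs_nonneg (X - n * a), abs_nonneg (Y - -(n * b))]
  · linarith [abs_nonneg (X - n * a), abs_nonneg (Y - -(n * b))]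
  · have := not_lt.1 (mt hP.2 h)
    linarith

lemma sum_sqrt_mul_le {K : ℕ} {n : ℝ} (hn : 0 ≤ n) {a : ℕ → ℝ} (ha : ∀ j, 0 ≤ a j)
    (hsum : ∑ j ∈ Finset.range K, a j = 1) :
    ∑ j ∈ Finset.range K, √(n * a j) ≤ √(K * n) := by
  refine Real.le_sqrt_of_sq_le ((sq_sum_le_card_mul_sum_sq).trans_eq ?_)
  rw [Finset.card_range, Finset.sum_congr rfl fun j _ => Real.sq_sqrt (mul_nonneg hn (ha j)),
    ← Finset.mul_sum, hsum, mul_one]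

/-- The expected risk of the binning classifier, for a fixed set of retained majority samples. -/
lemma integral_risk_usbClassifier_le {p q : ℝ → ℝ} (hpc : Continuous p) (hqc : Continuous q)
    (hp0 : ∀ x, 0 ≤ p x) (hq0 : ∀ x, 0 ≤ q x) (hp : ∀ x y, |p x - p y| ≤ |x - y|)
    (hq : ∀ x y, |q x - q y| ≤ |x - y|) (hp1 : ∫ x in Icc (0:ℝ) 1, p x = 1)
    (hq1 : ∫ x in Icc (0:ℝ) 1, q x = 1) {nmaj nmin K : ℕ} (hn : 0 < nmin) (hK : 0 < K)
    {s : Finset (Fin nmaj)} (hs : s.card = nmin) :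
    ∫ S, risk (usbClassifier nmaj nmin K s S)
        (testMeasure (labelMeasure p true) (labelMeasure q false))
        ∂sampleMeasure nmaj nmin (labelMeasure p true) (labelMeasure q false) ≤
      (featureMeasure fun x => min (p x) (q x)).real univ / 2 + 1 / K + √(K * nmin) / nmin := by
  have := isProbabilityMeasure_featureMeasure hpc hp0 hp1
  have := isProbabilityMeasure_featureMeasure hqc hq0 hq1
  have : IsProbabilityMeasure (labelMeasure p true) := by
    rw [labelMeasure_eq_map]; exact Measure.isProbabilityMeasure_map (by fun_prop)
  have : IsProbabilityMeasure (labelMeasure q false) := by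
    rw [labelMeasure_eq_map]; exact Measure.isProbabilityMeasure_map (by fun_prop)
  have hn' : (0:ℝ) < nmin := by exact_mod_cast hn
  have hK' : (0:ℝ) < K := by exact_mod_cast hK
  set a : ℕ → ℝ := fun j => (featureMeasure p).real (bin K j)
  set b : ℕ → ℝ := fun j => (featureMeasure q).real (bin K j)
  set μ := sampleMeasure nmaj nmin (labelMeasure p true) (labelMeasure q false) with hμ
  have : IsProbabilityMeasure μ := by rw [hμ, sampleMeasure]; infer_instance
  let X (j : ℕ) (w : Fin nmaj → ℝ × Bool) : ℝ := |∑ i ∈ s, binSign K j (w i) - nmin * a j|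
  let Y (j : ℕ) (w : Fin nmin → ℝ × Bool) : ℝ := |∑ i, binSign K j (w i) - -(nmin * b j)|
  have hX (j : ℕ) : Integrable (fun S : Sample nmaj nmin => X j S.1) μ ∧
      ∫ S, X j S.1 ∂μ ≤ √(nmin * a j) := by
    have h := integral_abs_sum_sub_le (P := labelMeasure p true) (measurable_binSign K j)
      (abs_binSign_le K j) s
    rw [integral_binSign, integral_binSign_sq, hs] at h
    simp only [sgnB, if_true, mul_one] at h
    refine ⟨h.1.comp_fst _, ?_⟩
    rw [hμ, sampleMeasure, integral_fun_fst, probReal_univ, one_smul]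
    exact h.2
  have hY (j : ℕ) : Integrable (fun S : Sample nmaj nmin => Y j S.2) μ ∧
      ∫ S, Y j S.2 ∂μ ≤ √(nmin * b j) := by
    have h := integral_abs_sum_sub_le (P := labelMeasure q false) (measurable_binSign K j)
      (abs_binSign_le K j) (Finset.univ : Finset (Fin nmin))
    rw [integral_binSign, integral_binSign_sq, Finset.card_univ, Fintype.card_fin] at h
    simp only [sgnB, Bool.false_eq_true, if_false, mul_neg, mul_one] at h
    refine ⟨h.1.comp_snd _, ?_⟩
    rw [hμ, sampleMeasure, integral_fun_snd, probReal_univ, one_smul]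
    exact h.2
  have hbound (S : Sample nmaj nmin) : risk (usbClassifier nmaj nmin K s S)
      (testMeasure (labelMeasure p true) (labelMeasure q false)) ≤
      (∑ j ∈ Finset.range K, (min (a j) (b j) + (X j S.1 + Y j S.2) / nmin)) / 2 := by
    refine (risk_binClassifier_le hpc hqc hK fun j => usbBinPred nmaj nmin K s S j).trans ?_
    gcongr with j
    exact ite_le_min_add_deviation hn' (usbBinPred_eq_true_iff nmaj nmin K s S j)
  have hXY (j : ℕ) : Integrable (fun S : Sample nmaj nmin => (X j S.1 + Y j S.2) / nmin) μ :=
    ((hX j).1.add (hY j).1).div_const _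
  have hterm (j : ℕ) : Integrable
      (fun S : Sample nmaj nmin => min (a j) (b j) + (X j S.1 + Y j S.2) / nmin) μ :=
    (integrable_const _).add (hXY j)
  have hint := integral_mono_of_nonneg (μ := μ) (.of_forall fun S => ENNReal.toReal_nonneg)
    ((integrable_finsetSum (Finset.range K) fun j _ => hterm j).div_const 2) (.of_forall hbound)
  refine hint.trans ?_
  rw [integral_div, integral_finsetSum _ fun j _ => hterm j]
  have hj (j : ℕ) (hj : j ∈ Finset.range K) :
      ∫ S, (min (a j) (b j) + (X j S.1 + Y j S.2) / nmin) ∂μ ≤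
        (featureMeasure fun x => min (p x) (q x)).real (bin K j) + 2 / (K:ℝ) ^ 2 +
          (√(nmin * a j) + √(nmin * b j)) / nmin := by
    rw [integral_add (integrable_const _) (hXY j), integral_div,
      integral_add (hX j).1 (hY j).1, integral_const, probReal_univ, one_smul]
    gcongr
    · exact min_featureMeasure_real_bin_le hpc hqc hp0 hq0 hp hq (Finset.mem_range.1 hj)
    · exact (hX j).2
    · exact (hY j).2
  have hmin0 (x : ℝ) : 0 ≤ min (p x) (q x) := le_min (hp0 x) (hq0 x)
  have htotal := Finset.sum_le_sum hj
  rw [Finset.sum_add_distrib, Finset.sum_add_distrib, Finset.sum_const, Finset.card_range,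
    nsmul_eq_mul, ← Finset.sum_div, Finset.sum_add_distrib,
    sum_featureMeasure_real_bin (hpc.min hqc) hmin0 hK] at htotal
  have hM : (featureMeasure fun x => min (p x) (q x)).real univ =
      ∫ x in Icc (0:ℝ) 1, min (p x) (q x) := by
    rw [featureMeasure_real (hpc.min hqc) hmin0 MeasurableSet.univ, univ_inter]
  have hsa : ∑ j ∈ Finset.range K, √(nmin * a j) ≤ √(K * nmin) :=
    sum_sqrt_mul_le hn'.le (fun _ => measureReal_nonneg)
      ((sum_featureMeasure_real_bin hpc hp0 hK).trans hp1)
  have hsb : ∑ j ∈ Finset.range K, √(nmin * b j) ≤ √(K * nmin) :=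
    sum_sqrt_mul_le hn'.le (fun _ => measureReal_nonneg)
      ((sum_featureMeasure_real_bin hqc hq0 hK).trans hq1)
  have hdev := div_le_div_of_nonneg_right (add_le_add hsa hsb) hn'.le
  have hK2 : (K:ℝ) * (2 / (K:ℝ) ^ 2) = 2 * (1 / K) := by field_simp
  have hring : (√(K * nmin) + √(K * nmin)) / nmin = 2 * (√((K:ℝ) * nmin) / nmin) := by ring
  rw [hM]
  linarith

lemma memLS.exists_lipschitz {P Q : Measure (ℝ × Bool)} (h : memLS P Q) :
    ∃ p q : ℝ → ℝ, Continuous p ∧ Continuous q ∧ (∀ x, 0 ≤ p x) ∧ (∀ x, 0 ≤ q x) ∧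
      (∀ x y, |p x - p y| ≤ |x - y|) ∧ (∀ x y, |q x - q y| ≤ |x - y|) ∧
      ∫ x in Icc (0:ℝ) 1, p x = 1 ∧ ∫ x in Icc (0:ℝ) 1, q x = 1 ∧
      P = labelMeasure p true ∧ Q = labelMeasure q false := by
  obtain ⟨p, q, hp0, hq0, hp, hq, hp1, hq1, rfl, rfl⟩ := h
  have hext {f : ℝ → ℝ} (hf : LipschitzOnWith 1 f (Icc 0 1)) :
      LipschitzWith 1 (IccExtend zero_le_one ((Icc (0:ℝ) 1).domRestrict f)) := by
    have := (lipschitzOnWith_iff_restrict.1 hf).comp (LipschitzWith.projIcc (zero_le_one (α := ℝ)))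
    rwa [one_mul] at this
  have heq (f : ℝ → ℝ) : ∀ x ∈ Icc (0:ℝ) 1,
      f x = IccExtend zero_le_one ((Icc (0:ℝ) 1).domRestrict f) x := fun x hx => by
    rw [IccExtend_of_mem _ _ hx, domRestrict_apply]
  have hdist {f : ℝ → ℝ} (hf : LipschitzWith 1 f) (x y : ℝ) : |f x - f y| ≤ |x - y| := by
    simpa [Real.dist_eq] using hf.dist_le_mul x y
  refine ⟨_, _, (hext hp).continuous, (hext hq).continuous, fun x => hp0 _, fun x => hq0 _,
    hdist (hext hp), hdist (hext hq), ?_, ?_, labelMeasure_congr (heq p) _,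
    labelMeasure_congr (heq q) _⟩
  · rwa [← setIntegral_congr_fun measurableSet_Icc (heq p)]
  · rwa [← setIntegral_congr_fun measurableSet_Icc (heq q)]

/-- **Theorem (label shift upper bound for undersampled binning).** There are absolute
constants `c, C > 0` such that for every `(P_maj, P_min) ∈ 𝒫_LS`, the expected excess risk
of the undersampled binning estimator with `K = c ⌈n_min^{1/3}⌉` bins is at most
`C / n_min^{1/3}`. -/
theorem undersampled_binning_label_shift_upper_bound :
    ∃ c : ℕ, 0 < c ∧ ∃ C : ℝ, 0 < C ∧
      ∀ (nmaj nmin : ℕ), 1 ≤ nmin → nmin < nmaj →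
        ∀ Pmaj Pmin : Measure (ℝ × Bool), memLS Pmaj Pmin →
          usbExcessRisk nmaj nmin (c * ⌈(nmin : ℝ) ^ ((1:ℝ)/3)⌉₊) Pmaj Pmin ≤
            C / (nmin : ℝ) ^ ((1:ℝ)/3) := by
  refine ⟨1, one_pos, 3, by norm_num, fun nmaj nmin hn hlt Pmaj Pmin hLS => ?_⟩
  obtain ⟨p, q, hpc, hqc, hp0, hq0, hp, hq, hp1, hq1, rfl, rfl⟩ := hLS.exists_lipschitz
  rw [one_mul]
  set t : ℝ := (nmin : ℝ) ^ ((1:ℝ)/3) with ht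
  set K : ℕ := ⌈t⌉₊ with hKdef
  have ht1 : 1 ≤ t := Real.one_le_rpow (by exact_mod_cast hn) (by norm_num)
  have ht3 : (nmin : ℝ) = t ^ 3 := by
    rw [ht, ← Real.rpow_natCast, ← Real.rpow_mul (Nat.cast_nonneg _)]; norm_num
  have hKt : t ≤ K := Nat.le_ceil t
  have hK2 : (K:ℝ) ≤ 2 * t := by linarith [Nat.ceil_lt_add_one (show 0 ≤ t by linarith)]
  have hK : 0 < K := Nat.ceil_pos.2 (by linarith)
  have hcard : (0:ℝ) < ((Finset.powersetCard nmin (Finset.univ : Finset (Fin nmaj))).card : ℝ) := by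
    rw [Finset.card_powersetCard, Finset.card_univ, Fintype.card_fin]
    exact_mod_cast Nat.choose_pos hlt.le
  have havg := Finset.sum_le_card_nsmul (Finset.powersetCard nmin (Finset.univ : Finset (Fin nmaj)))
    _ _ fun s hs => integral_risk_usbClassifier_le hpc hqc hp0 hq0 hp hq hp1 hq1 hn hK
      (Finset.mem_powersetCard.1 hs).2
  rw [nsmul_eq_mul, ← div_le_iff₀' hcard] at havg
  have hbayes := half_overlap_le_bayesRisk hpc hqc
  have hbias : 1 / (K:ℝ) ≤ 1 / t := by gcongr
  have hdev : √(K * nmin) / nmin ≤ 2 / t := by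
    have htpos : 0 < t := by linarith
    have hsqrt : √((K:ℝ) * nmin) ≤ 2 * t ^ 2 := by
      refine Real.sqrt_le_iff.2 ⟨by positivity, ?_⟩
      rw [ht3]
      nlinarith [mul_le_mul_of_nonneg_right hK2 (pow_pos htpos 3).le, pow_pos htpos 4]
    calc √((K:ℝ) * nmin) / nmin ≤ 2 * t ^ 2 / t ^ 3 := by rw [ht3] at hsqrt ⊢; gcongr
      _ = 2 / t := by field_simp
  have hsplit : (3:ℝ) / t = 1 / t + 2 / t := by ring
  rw [usbExcessRisk, hsplit]
  linarith
end
end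

section
/- For any positive integer K, ∫₀^{1/K} log( (1 + φ_K(x − 1/(2K))) / (1 − φ_K(x − 1/(2K))) ) · (1 + φ_K(x − 1/(2K))) dx ≤ 1/(3K³), and likewise ∫₀^{1/K} log( (1 − φ_K(x − 1/(2K))) / (1 + φ_K(x − 1/(2K))) ) · (1 − φ_K(x − 1/(2K))) dx ≤ 1/(3K³). -/
open MeasureTheory Set
open scoped ENNReal Classical

noncomputable section

theorem log_div_mul_le {t : ℝ} (ht : |t| ≤ 1 / 4) :
    Real.log ((1 + t) / (1 - t)) * (1 + t) ≤ 2 * t + 16 / 3 * t ^ 2 := by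
  obtain ⟨h₁, h₂⟩ := abs_le.mp ht
  have hpos : 0 < 1 - t := by linarith
  have hlog : Real.log ((1 + t) / (1 - t)) ≤ (1 + t) / (1 - t) - 1 :=
    Real.log_le_sub_one_of_pos (div_pos (by linarith) hpos)
  refine (mul_le_mul_of_nonneg_right hlog (by linarith : 0 ≤ 1 + t)).trans ?_
  have heq : ((1 + t) / (1 - t) - 1) * (1 + t) = 2 * t * (1 + t) / (1 - t) := by
    field_simp
    ring
  rw [heq, div_le_iff₀ hpos]
  nlinarith [mul_nonneg (sq_nonneg t) (by linarith : 0 ≤ 1 - 4 * t)]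

theorem setIntegral_log_div_mul_le {g : ℝ → ℝ} {a c : ℝ} (ha : 0 ≤ a) (hc : c ≤ 1 / 4)
    (hg : Measurable g) (hbound : ∀ x, |g x| ≤ c) (hzero : ∫ x in Icc 0 a, g x = 0) :
    ∫ x in Icc 0 a, Real.log ((1 + g x) / (1 - g x)) * (1 + g x) ≤ 16 / 3 * c ^ 2 * a := by
  by_cases hint : IntegrableOn
      (fun x => Real.log ((1 + g x) / (1 - g x)) * (1 + g x)) (Icc 0 a)
  · have hgint : IntegrableOn g (Icc 0 a) :=
      IntegrableOn.of_bound measure_Icc_lt_top hg.aestronglyMeasurable c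
        (Filter.Eventually.of_forall hbound)
    have hconst : IntegrableOn (fun _ : ℝ => 16 / 3 * c ^ 2) (Icc 0 a) :=
      integrableOn_const measure_Icc_lt_top.ne
    calc ∫ x in Icc 0 a, Real.log ((1 + g x) / (1 - g x)) * (1 + g x)
        ≤ ∫ x in Icc 0 a, (2 * g x + 16 / 3 * c ^ 2) := by
          refine integral_mono hint ((hgint.const_mul 2).add hconst) fun x => ?_
          have hsq : g x ^ 2 ≤ c ^ 2 := sq_le_sq' (abs_le.mp (hbound x)).1 (abs_le.mp (hbound x)).2
          have := log_div_mul_le ((hbound x).trans hc)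
          dsimp only
          linarith
      _ = 16 / 3 * c ^ 2 * a := by
          rw [integral_add (hgint.const_mul 2) hconst, integral_const_mul, hzero]
          simp [ha, mul_comm]
  · rw [integral_undef hint]
    positivity

theorem measurable_hatFun (K : ℕ) : Measurable (hatFun K) := by
  unfold hatFun
  refine Measurable.ite measurableSet_Icc (by fun_prop)
    (Measurable.ite measurableSet_Icc (by fun_prop) measurable_const)

theorem one_div_two_mul_eq (K : ℕ) : 1 / (2 * (K : ℝ)) = 2 * (1 / (4 * (K : ℝ))) := by
  rw [one_div, one_div, mul_inv, mul_inv]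
  ring

theorem abs_hatFun_le (K : ℕ) (x : ℝ) : |hatFun K x| ≤ 1 / (4 * (K : ℝ)) := by
  have hpos : 0 ≤ 1 / (4 * (K : ℝ)) := by positivity
  rw [abs_le]
  simp only [hatFun, one_div_two_mul_eq, mem_Icc]
  generalize 1 / (4 * (K : ℝ)) = h at *
  grind

theorem hatFun_neg (K : ℕ) (x : ℝ) : hatFun K (-x) = -hatFun K x := by
  have hpos : 0 ≤ 1 / (4 * (K : ℝ)) := by positivity
  simp only [hatFun, one_div_two_mul_eq, mem_Icc]
  generalize 1 / (4 * (K : ℝ)) = h at *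
  grind

theorem setIntegral_hatFun_sub (K : ℕ) :
    ∫ x in Icc (0 : ℝ) (1 / (K : ℝ)), hatFun K (x - 1 / (2 * (K : ℝ))) = 0 := by
  have hle : (0 : ℝ) ≤ 1 / (K : ℝ) := by positivity
  have hhalf : 1 / (K : ℝ) - 1 / (2 * (K : ℝ)) = 1 / (2 * (K : ℝ)) := by
    rw [one_div, one_div, mul_inv]
    ring
  rw [integral_Icc_eq_integral_Ioc, ← intervalIntegral.integral_of_le hle,
    intervalIntegral.integral_comp_sub_right, hhalf, zero_sub]
  have hneg := intervalIntegral.integral_comp_neg (a := -(1 / (2 * (K : ℝ))))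
    (b := 1 / (2 * (K : ℝ))) (hatFun K)
  simp only [hatFun_neg, intervalIntegral.integral_neg, neg_neg] at hneg
  linarith

/-- **Lemma.** For any positive integer `K`,
`∫₀^{1/K} log((1 + φ_K(x - 1/(2K)))/(1 - φ_K(x - 1/(2K)))) (1 + φ_K(x - 1/(2K))) dx ≤ 1/(3K³)`,
and likewise with `+` and `-` interchanged. -/
theorem kl_hatFun_integral (K : ℕ) (hK : 0 < K) :
    (∫ x in Icc (0:ℝ) (1/(K:ℝ)),
        Real.log ((1 + hatFun K (x - 1/(2*(K:ℝ)))) / (1 - hatFun K (x - 1/(2*(K:ℝ))))) *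
          (1 + hatFun K (x - 1/(2*(K:ℝ))))) ≤ 1/(3*(K:ℝ)^3) ∧
    (∫ x in Icc (0:ℝ) (1/(K:ℝ)),
        Real.log ((1 - hatFun K (x - 1/(2*(K:ℝ)))) / (1 + hatFun K (x - 1/(2*(K:ℝ))))) *
          (1 - hatFun K (x - 1/(2*(K:ℝ))))) ≤ 1/(3*(K:ℝ)^3) := by
  have hK1 : (1 : ℝ) ≤ K := by exact_mod_cast hK
  have hc : 1 / (4 * (K : ℝ)) ≤ 1 / 4 := by
    gcongr
    linarith
  have hval : 16 / 3 * (1 / (4 * (K : ℝ))) ^ 2 * (1 / K) = 1 / (3 * (K : ℝ) ^ 3) := by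
    field_simp
    norm_num
  have hmeas : Measurable fun x : ℝ => hatFun K (x - 1 / (2 * (K : ℝ))) :=
    (measurable_hatFun K).comp (measurable_id.sub_const _)
  have ha : (0 : ℝ) ≤ 1 / K := by positivity
  rw [← hval]
  refine ⟨setIntegral_log_div_mul_le ha hc hmeas (fun x => abs_hatFun_le K _)
    (setIntegral_hatFun_sub K), ?_⟩
  have hminus := setIntegral_log_div_mul_le ha hc hmeas.neg
    (fun x => by simpa only [Pi.neg_apply, abs_neg] using abs_hatFun_le K _)
    (by simp only [Pi.neg_apply, integral_neg, setIntegral_hatFun_sub, neg_zero])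
  simpa only [Pi.neg_apply, sub_neg_eq_add, ← sub_eq_add_neg] using hminus
end
end
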